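/- Let X be a transitive countable Markov shift, φ: X → ℝ measurable and μ_φ a Gibbs state for φ. Let l ≥ 1, let φ_1,…,φ_l be bounded uniformly continuous real functions on X and α_1,…,α_l ∈ ℝ, and set V = {μ ∈ M : ∫φ_j dμ > α_j for j = 1,…,l}. Then liminf_{n→∞} (1/n) log ξ_n(V) ≥ sup{F(μ) : μ ∈ V}. If moreover X is finitely primitive, the same inequality holds with ξ_n replaced by η_n, η_{a,n}, ζ_{y,n} and ζ_{a,y,n} for any a ∈ S and y ∈ X. -/

import Mathlib

open MeasureTheory Filter Topology Set
open scoped ENNReal NNReal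

namespace CMS

/-! ### Generic dynamical notions -/

variable {X : Type*}

/-- Birkhoff sum `S_n φ`. -/
noncomputable def birkhoff (T : X → X) (φ : X → ℝ) (n : ℕ) (x : X) : ℝ :=
  ∑ i ∈ Finset.range n, φ (T^[i] x)

/-- A measure is invariant under `T`. -/
def Invariant [MeasurableSpace X] (T : X → X) (μ : Measure X) : Prop :=
  Measure.map T μ = μ

/-- `∫ φ dμ > -∞`, i.e. the negative part of `φ` is integrable. -/
def IntegralGtBot [MeasurableSpace X] (φ : X → ℝ) (μ : Measure X) : Prop :=
  (∫⁻ x, ENNReal.ofReal (-φ x) ∂μ) ≠ ⊤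

/-- The integral of `φ`, with values in `EReal` (defined whenever one of the parts is finite). -/
noncomputable def eintegral [MeasurableSpace X] (φ : X → ℝ) (μ : Measure X) : EReal :=
  ((∫⁻ x, ENNReal.ofReal (φ x) ∂μ : ℝ≥0∞) : EReal) -
    ((∫⁻ x, ENNReal.ofReal (-φ x) ∂μ : ℝ≥0∞) : EReal)

/-- Entropy of the countable partition induced by a map `g` with countable range. -/
noncomputable def partitionEntropy [MeasurableSpace X] {α : Type*} (μ : Measure X) (g : X → α) :
    ℝ≥0∞ :=
  ∑' a : α, ENNReal.ofReal (-((μ (g ⁻¹' {a})).toReal * Real.log ((μ (g ⁻¹' {a})).toReal)))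

/-- Kolmogorov–Sinaĭ entropy of `T` with respect to `μ`: the supremum over finite measurable
partitions (coded by maps `X → ℕ` with finite range) of the asymptotic entropy of iterated
joins of the partition. -/
noncomputable def entropy [MeasurableSpace X] (T : X → X) (μ : Measure X) : ℝ≥0∞ :=
  ⨆ (p : X → ℕ) (_ : Measurable p ∧ (Set.range p).Finite),
    atTop.liminf fun n : ℕ =>
      ENNReal.ofReal ((n : ℝ)⁻¹) * partitionEntropy μ (fun x => fun i : Fin n => p (T^[i] x))

/-- The empirical measure `δ_x^n = (1/n) ∑_{i<n} δ_{T^i x}` (with junk convention `n = 0 ↦ n = 1`,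
irrelevant since only `n ≥ 1` is ever used). -/
noncomputable def empirical [MeasurableSpace X] (T : X → X) (x : X) (n : ℕ) :
    ProbabilityMeasure X :=
  ⟨((max n 1 : ℕ) : ℝ≥0∞)⁻¹ • ∑ i ∈ Finset.range (max n 1), Measure.dirac (T^[i] x), by
    refine ⟨?_⟩
    have h1 : (∑ i ∈ Finset.range (max n 1), Measure.dirac (T^[i] x)) Set.univ
        = ((max n 1 : ℕ) : ℝ≥0∞) := by
      rw [Measure.finset_sum_apply]
      simp
    rw [Measure.smul_apply, h1, smul_eq_mul, ENNReal.inv_mul_cancel] <;> simp⟩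

noncomputable instance [MeasurableSpace X] [TopologicalSpace X] [OpensMeasurableSpace X] :
    MeasurableSpace (ProbabilityMeasure X) := borel _

/-- Sets of periodic points. -/
def perSet (T : X → X) (n : ℕ) : Set X := {x | T^[n] x = x}

/-- Sets of iterated preimages of a point. -/
def preimSet (T : X → X) (n : ℕ) (y : X) : Set X := {x | T^[n] x = y}

/-- The partition function `Z_n(φ, C)` over a subset `C`. -/
noncomputable def Zfn [MeasurableSpace X] (T : X → X) (φ : X → ℝ) (n : ℕ) (C : Set X) : ℝ≥0∞ :=
  ∑' x : C, ENNReal.ofReal (Real.exp (birkhoff T φ n x))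

/-- The distribution of the empirical measures under `μ`. -/
noncomputable def empDistr [MeasurableSpace X] [TopologicalSpace X] [OpensMeasurableSpace X]
    (T : X → X) (μ : Measure X) (n : ℕ) : Measure (ProbabilityMeasure X) :=
  Measure.map (fun x => empirical T x n) μ

/-- The distribution `Z_n(φ,C)⁻¹ ∑_{x ∈ C} e^{S_nφ(x)} δ_{δ_x^n}` on the space of probability
measures, for a countable set `C` (of weighted periodic points or iterated preimages). -/
noncomputable def weightedDistr [MeasurableSpace X] [TopologicalSpace X] [OpensMeasurableSpace X]
    (T : X → X) (φ : X → ℝ) (n : ℕ) (C : Set X) : Measure (ProbabilityMeasure X) :=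
  (Zfn T φ n C)⁻¹ •
    Measure.sum (fun x : C =>
      ENNReal.ofReal (Real.exp (birkhoff T φ n x)) • Measure.dirac (empirical T (x : X) n))

/-! ### Large deviations notions -/

variable {Y : Type*}

/-- The large deviation principle for a sequence of (sub)probability measures with rate
function `J`. -/
def HasLDP [TopologicalSpace Y] [MeasurableSpace Y] (μ : ℕ → Measure Y) (J : Y → EReal) : Prop :=
  (∀ G : Set Y, IsOpen G →
      -(⨅ y ∈ G, J y) ≤
        atTop.liminf fun n : ℕ => (((n : ℝ)⁻¹ : ℝ) : EReal) * ENNReal.log (μ n G)) ∧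
  (∀ K : Set Y, IsClosed K →
      atTop.limsup (fun n : ℕ => (((n : ℝ)⁻¹ : ℝ) : EReal) * ENNReal.log (μ n K)) ≤
        -(⨅ y ∈ K, J y))

/-- Exponential tightness of a sequence of measures. -/
def ExpTight [TopologicalSpace Y] [MeasurableSpace Y] (μ : ℕ → Measure Y) : Prop :=
  ∀ L : ℝ, 0 < L → ∃ K : Set Y, IsCompact K ∧
    atTop.limsup (fun n : ℕ => (((n : ℝ)⁻¹ : ℝ) : EReal) * ENNReal.log (μ n Kᶜ)) ≤ ((-L : ℝ) : EReal)

/-- A good rate function: lower semicontinuous with compact sublevel sets. -/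
def GoodRate [TopologicalSpace Y] (J : Y → EReal) : Prop :=
  LowerSemicontinuous J ∧ ∀ α : ℝ, 0 ≤ α → IsCompact {y | J y ≤ (α : EReal)}

/-- The rate function `I(μ) = - inf_{G ∋ μ} sup_G F`. -/
noncomputable def rateOf [TopologicalSpace Y] (F : Y → EReal) (μ : Y) : EReal :=
  -(⨅ (G : Set Y) (_ : IsOpen G ∧ μ ∈ G), ⨆ ν ∈ G, F ν)

/-- The convex combination `t μ + (1-t) ν` of two probability measures. -/
noncomputable def mix [MeasurableSpace X] (t : ℝ) (h0 : 0 ≤ t) (h1 : t ≤ 1)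
    (μ ν : ProbabilityMeasure X) : ProbabilityMeasure X :=
  ⟨ENNReal.ofReal t • (μ : Measure X) + ENNReal.ofReal (1 - t) • (ν : Measure X), by
    refine ⟨?_⟩
    simp only [Measure.add_apply, Measure.smul_apply, smul_eq_mul, measure_univ, mul_one]
    rw [← ENNReal.ofReal_add h0 (by linarith)]
    norm_num⟩

/-- Convexity of a rate function on probability measures. -/
def ConvexRate [MeasurableSpace X] (J : ProbabilityMeasure X → EReal) : Prop :=
  ∀ μ ν : ProbabilityMeasure X, ∀ t : ℝ, ∀ (h0 : 0 ≤ t) (h1 : t ≤ 1),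
    J (mix t h0 h1 μ ν) ≤ ((t : ℝ) : EReal) * J μ + ((1 - t : ℝ) : EReal) * J ν

-- The free energy functional `F`.
open Classical in
noncomputable def freeEnergy [MeasurableSpace X] (T : X → X) (φ : X → ℝ) (P : ℝ)
    (ν : ProbabilityMeasure X) : EReal :=
  if Invariant T (ν : Measure X) ∧ IntegralGtBot φ (ν : Measure X)
  then ((entropy T (ν : Measure X) : ℝ≥0∞) : EReal) + eintegral φ (ν : Measure X) - ((P : ℝ) : EReal)
  else ⊥

/-! ### Countable Markov shifts -/

variable {S : Type*}

/-- The topological Markov shift with alphabet `S` and transition relation `A`. -/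
def Space (A : S → S → Prop) : Type _ := {x : ℕ → S // ∀ i, A (x i) (x (i + 1))}

variable (A : S → S → Prop)

instance [TopologicalSpace S] : TopologicalSpace (Space A) :=
  inferInstanceAs (TopologicalSpace {x : ℕ → S // ∀ i, A (x i) (x (i + 1))})

noncomputable instance [TopologicalSpace S] : MeasurableSpace (Space A) := borel _

instance [TopologicalSpace S] : BorelSpace (Space A) := ⟨rfl⟩

/-- The left shift. -/
def shift : Space A → Space A := fun x => ⟨fun i => x.1 (i + 1), fun i => x.2 (i + 1)⟩

/-- Admissible words. -/
def Admissible (w : List S) : Prop := w ≠ [] ∧ w.Chain' A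

/-- The cylinder set of a word. -/
def cylinder (w : List S) : Set (Space A) := {x | ∀ i : Fin w.length, x.1 i = w.get i}

variable {A}

/-- The initial word of length `n` of a point. -/
def word (x : Space A) (n : ℕ) : List S := List.ofFn (fun i : Fin n => x.1 i)

variable (A)

/-- `μ` is a Gibbs state for the potential `φ` with constants `c₀` and `P`. -/
def IsGibbsWith [TopologicalSpace S] (φ : Space A → ℝ) (μ : Measure (Space A)) (c₀ P : ℝ) :
    Prop :=
  ∀ n : ℕ, 1 ≤ n → ∀ x : Space A,
    c₀⁻¹ * Real.exp (-(P * n) + birkhoff (shift A) φ n x)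
        ≤ (μ (cylinder A (word x n))).toReal ∧
      (μ (cylinder A (word x n))).toReal
        ≤ c₀ * Real.exp (-(P * n) + birkhoff (shift A) φ n x)

/-- `μ` is a Gibbs state for `φ`. -/
def IsGibbs [TopologicalSpace S] (φ : Space A → ℝ) (μ : Measure (Space A)) : Prop :=
  ∃ c₀ P : ℝ, 1 ≤ c₀ ∧ IsGibbsWith A φ μ c₀ P

/-- The transition matrix has no row or column identically zero. -/
def NoZeroRowCol : Prop := (∀ a : S, ∃ b, A a b) ∧ ∀ b : S, ∃ a, A a b

/-- Finite irreducibility. -/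
def FinitelyIrreducible : Prop :=
  ∃ Λ : Finset (List S), ∀ v w : List S, Admissible A v → Admissible A w →
    ∃ l ∈ Λ, Admissible A (v ++ l ++ w)

/-- Finite primitiveness. -/
def FinitelyPrimitive : Prop :=
  ∃ Λ : Finset (List S), (∃ N : ℕ, ∀ l ∈ Λ, l.length = N) ∧
    ∀ v w : List S, Admissible A v → Admissible A w →
      ∃ l ∈ Λ, Admissible A (v ++ l ++ w)

/-- Topological transitivity. -/
def TopTransitive : Prop :=
  ∀ a b : S, ∃ n : ℕ, 1 ≤ n ∧
    (cylinder A [a] ∩ (shift A)^[n] ⁻¹' (cylinder A [b])).Nonempty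

/-- Varadhan's functional `Q(ψ) = sup_μ (∫ψ dμ - I(μ))`. -/
noncomputable def varQ {X : Type*} [MeasurableSpace X] (I : ProbabilityMeasure X → EReal)
    (ψ : X → ℝ) : EReal :=
  ⨆ μ : ProbabilityMeasure X, (((∫ x, ψ x ∂(μ : Measure X)) : ℝ) : EReal) - I μ

/-- `φ` is uniformly continuous for the standard metric of the shift space. -/
def UnifCont (φ : Space A → ℝ) : Prop :=
  ∀ ε : ℝ, 0 < ε → ∃ N : ℕ, ∀ x y : Space A, (∀ i < N, x.1 i = y.1 i) → |φ x - φ y| ≤ ε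

/-- `φ` is bounded. -/
def Bdd (φ : Space A → ℝ) : Prop := ∃ C : ℝ, ∀ x : Space A, |φ x| ≤ C

end CMS
namespace CMS

section Basics

variable {S : Type*} {A : S → S → Prop}

/-- The set of points agreeing with `x` on the first `n` coordinates. -/
def cyl (x : Space A) (n : ℕ) : Set (Space A) := {y | ∀ i < n, y.1 i = x.1 i}

/-- A function determined by the first `n` coordinates. -/
def DependsOnFirst {α : Type*} (n : ℕ) (f : Space A → α) : Prop :=
  ∀ x y : Space A, y ∈ cyl x n → f y = f x

lemma mem_cyl_self (x : Space A) (n : ℕ) : x ∈ cyl x n := fun _ _ => rfl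

lemma cyl_eq_of_mem {x y : Space A} {n : ℕ} (h : y ∈ cyl x n) : cyl y n = cyl x n := by
  ext z
  exact ⟨fun hz i hi => (hz i hi).trans (h i hi), fun hz i hi => (hz i hi).trans (h i hi).symm⟩

lemma cyl_anti (x : Space A) {m n : ℕ} (h : m ≤ n) : cyl x n ⊆ cyl x m :=
  fun _ hy i hi => hy i (hi.trans_le h)

lemma cyl_disjoint {x y : Space A} {n : ℕ} (h : y ∉ cyl x n) : Disjoint (cyl x n) (cyl y n) := by
  rw [Set.disjoint_left]
  intro z hx hy
  exact h fun i hi => (hy i hi).symm.trans (hx i hi)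

lemma cylinder_word (x : Space A) (n : ℕ) : cylinder A (word x n) = cyl x n := by
  ext y
  constructor
  · intro h i hi
    have := h ⟨i, by simpa [word] using hi⟩
    simpa [word] using this
  · intro h i
    have hi : (i : ℕ) < n := by simpa [word] using i.2
    rw [List.get_eq_getElem]
    simp only [word, List.getElem_ofFn]
    exact h i hi

lemma shift_iterate_apply (x : Space A) (n i : ℕ) : ((shift A)^[n] x).1 i = x.1 (i + n) := by
  induction n generalizing x i with
  | zero => rfl
  | succ n ih => rw [Function.iterate_succ_apply, ih]; simp [shift]; congr 1

lemma DependsOnFirst.mono {α : Type*} {m n : ℕ} (h : m ≤ n) {f : Space A → α}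
    (hf : DependsOnFirst m f) : DependsOnFirst n f :=
  fun x y hy => hf x y (cyl_anti x h hy)

lemma shift_iterate_mem_cyl {x y : Space A} {n i m : ℕ} (h : y ∈ cyl x n) (him : i + m ≤ n) :
    (shift A)^[i] y ∈ cyl ((shift A)^[i] x) m := by
  intro j hj
  rw [shift_iterate_apply, shift_iterate_apply]
  exact h _ (by omega)

/-- The algebra of finite-range cylinder sets. -/
def cylAlgebra (A : S → S → Prop) : Set (Set (Space A)) :=
  {s | ∃ n, DependsOnFirst n (fun x => x ∈ s)}

lemma isSetAlgebra_cylAlgebra : IsSetAlgebra (cylAlgebra A) where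
  empty_mem := ⟨0, fun _ _ _ => rfl⟩
  compl_mem := by
    rintro s ⟨n, hn⟩
    exact ⟨n, fun x y h => by
      have := hn x y h
      simp only [Set.mem_compl_iff] at this ⊢
      rw [this]⟩
  union_mem := by
    rintro s t ⟨n, hn⟩ ⟨m, hm⟩
    refine ⟨max n m, fun x y h => ?_⟩
    have h1 := hn.mono (le_max_left n m) x y h
    have h2 := hm.mono (le_max_right n m) x y h
    simp only [Set.mem_union] at h1 h2 ⊢
    rw [h1, h2]

variable [TopologicalSpace S]

lemma continuous_coord (i : ℕ) : Continuous fun x : Space A => x.1 i :=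
  (continuous_apply i).comp continuous_subtype_val

lemma continuous_shift : Continuous (shift A) :=
  Continuous.subtype_mk (continuous_pi fun i => continuous_coord (i + 1)) _

lemma measurable_shift : Measurable (shift A) := continuous_shift.measurable

lemma exists_cyl_subset {U : Set (Space A)} (hU : IsOpen U) {x : Space A} (hx : x ∈ U) :
    ∃ n, cyl x n ⊆ U := by
  obtain ⟨V, hV, rfl⟩ := isOpen_induced_iff.1 hU
  rw [isOpen_pi_iff] at hV
  obtain ⟨I, u, hu, hsub⟩ := hV x.1 hx
  refine ⟨I.sup id + 1, fun y hy => hsub fun i hi => ?_⟩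
  rw [hy i (Nat.lt_succ_of_le (Finset.le_sup (f := id) hi))]
  exact (hu i hi).2

variable [DiscreteTopology S]

lemma isOpen_cyl (x : Space A) (n : ℕ) : IsOpen (cyl x n) := by
  have : cyl x n = ⋂ i ∈ Finset.range n, (fun y : Space A => y.1 i) ⁻¹' {x.1 i} := by
    ext y; simp [cyl]
  rw [this]
  exact isOpen_biInter_finset fun i _ => (isOpen_discrete _).preimage (continuous_coord i)

lemma measurableSet_cyl (x : Space A) (n : ℕ) : MeasurableSet (cyl x n) :=
  (isOpen_cyl x n).measurableSet

lemma DependsOnFirst.isLocallyConstant {α : Type*} {n : ℕ} {f : Space A → α}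
    (hf : DependsOnFirst n f) : IsLocallyConstant f := by
  rw [IsLocallyConstant.iff_exists_open]
  exact fun x => ⟨cyl x n, isOpen_cyl x n, mem_cyl_self x n, fun y hy => hf x y hy⟩

lemma DependsOnFirst.measurable {α : Type*} [MeasurableSpace α] {n : ℕ} {f : Space A → α}
    (hf : DependsOnFirst n f) : Measurable f := by
  intro s _
  exact (hf.isLocallyConstant s).measurableSet

lemma generateFrom_cylAlgebra :
    (inferInstance : MeasurableSpace (Space A)) = MeasurableSpace.generateFrom (cylAlgebra A) := by
  apply le_antisymm
  · refine MeasurableSpace.generateFrom_le fun U hU => ?_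
    have : U = ⋃ n, {x | cyl x n ⊆ U} := by
      ext x
      simp only [Set.mem_iUnion, Set.mem_ofPred_eq]
      exact ⟨exists_cyl_subset hU, fun ⟨n, hn⟩ => hn (mem_cyl_self x n)⟩
    rw [this]
    refine MeasurableSet.iUnion fun n => MeasurableSpace.measurableSet_generateFrom
      ⟨n, fun x y h => ?_⟩
    simp only [Set.mem_ofPred_eq, cyl_eq_of_mem h]
  · refine MeasurableSpace.generateFrom_le ?_
    rintro s ⟨n, hn⟩
    exact measurableSet_setOfPred.2 hn.measurable

end Basics

end CMS

namespace CMS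

section Birkhoff

variable {X : Type*}

lemma birkhoff_add (T : X → X) (φ : X → ℝ) (m n : ℕ) (x : X) :
    birkhoff T φ (m + n) x = birkhoff T φ m x + birkhoff T φ n (T^[m] x) := by
  simp only [birkhoff, Finset.sum_range_add, ← Function.iterate_add_apply, add_comm]

lemma abs_birkhoff_le {T : X → X} {φ : X → ℝ} {C : ℝ} (hC : ∀ x, |φ x| ≤ C) (n : ℕ) (x : X) :
    |birkhoff T φ n x| ≤ n * C := by
  refine (Finset.abs_sum_le_sum_abs _ _).trans ?_
  refine (Finset.sum_le_sum fun i _ => hC (T^[i] x)).trans ?_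
  simp

lemma Invariant.measurePreserving [MeasurableSpace X] {T : X → X} (hT : Measurable T)
    {μ : Measure X} (h : Invariant T μ) : MeasurePreserving T μ μ := ⟨hT, h⟩

lemma integrable_birkhoff [MeasurableSpace X] {T : X → X} {μ : Measure X}
    (hT : MeasurePreserving T μ μ) {φ : X → ℝ} (hφ : Integrable φ μ) (n : ℕ) :
    Integrable (birkhoff T φ n) μ :=
  integrable_finsetSum _ fun i _ => (hT.iterate i).integrable_comp_of_integrable hφ

lemma integral_birkhoff [MeasurableSpace X] {T : X → X} {μ : Measure X}
    (hT : MeasurePreserving T μ μ) {φ : X → ℝ} (hφ : Integrable φ μ) (n : ℕ) :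
    ∫ x, birkhoff T φ n x ∂μ = n * ∫ x, φ x ∂μ := by
  have h : ∀ i : ℕ, ∫ x, φ (T^[i] x) ∂μ = ∫ x, φ x ∂μ := fun i => by
    have hi := hT.iterate i
    conv_rhs => rw [← hi.map_eq]
    rw [integral_map hi.measurable.aemeasurable]
    rw [hi.map_eq]
    exact hφ.aestronglyMeasurable
  simp only [birkhoff]
  rw [integral_finsetSum _ fun i _ => by
    simpa [Function.comp_def] using (hT.iterate i).integrable_comp_of_integrable hφ]
  simp [h]

lemma exists_finset_measure_compl_lt {ι : Type*} [Countable ι] [MeasurableSpace X] (μ : Measure X)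
    [IsFiniteMeasure μ] {f : X → ι} (hf : ∀ i, MeasurableSet (f ⁻¹' {i})) {ε : ℝ} (hε : 0 < ε) :
    ∃ F : Finset ι, μ.real {x | f x ∉ F} < ε := by
  have hs : ∑' i, μ (f ⁻¹' {i}) ≠ ⊤ := by
    refine ne_top_of_le_ne_top (measure_ne_top μ Set.univ)
      (tsum_measure_le_measure_univ (fun i => (hf i).nullMeasurableSet) fun i j hij => ?_)
    exact (Disjoint.preimage f (by simpa using hij)).aedisjoint
  have := (ENNReal.tendsto_tsum_compl_atTop_zero hs).eventually
    (gt_mem_nhds (ENNReal.ofReal_pos.2 hε))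
  obtain ⟨F, hF⟩ := this.exists
  refine ⟨F, ?_⟩
  have hle : μ {x | f x ∉ F} ≤ ∑' i : {i // i ∉ F}, μ (f ⁻¹' {(i : ι)}) := by
    refine (measure_mono ?_).trans (measure_iUnion_le _)
    intro x hx
    exact Set.mem_iUnion.2 ⟨⟨f x, hx⟩, rfl⟩
  rw [measureReal_def]
  exact (ENNReal.toReal_lt_of_lt_ofReal (hle.trans_lt hF))

end Birkhoff

section Shift

variable {S : Type*} {A : S → S → Prop}

lemma exists_birkhoff_variation {φ : Space A → ℝ} (hu : UnifCont A φ) (hb : Bdd A φ) {ε : ℝ}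
    (hε : 0 < ε) : ∃ D : ℝ, 0 ≤ D ∧ ∀ (n : ℕ) (x y : Space A), y ∈ cyl x n →
      |birkhoff (shift A) φ n y - birkhoff (shift A) φ n x| ≤ n * ε + D := by
  obtain ⟨N, hN⟩ := hu ε hε
  obtain ⟨C, hC⟩ := hb
  by_cases hX : Nonempty (Space A)
  swap
  · exact ⟨0, le_rfl, fun n x => (hX ⟨x⟩).elim⟩
  obtain ⟨x₀⟩ := hX
  have hC0 : 0 ≤ C := (abs_nonneg _).trans (hC x₀)
  refine ⟨N * (2 * C), by positivity, fun n x y hy => ?_⟩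
  have hd : ∀ z w : Space A, |φ z - φ w| ≤ 2 * C := fun z w => by
    have h1 := abs_le.1 (hC z)
    have h2 := abs_le.1 (hC w)
    exact abs_le.2 ⟨by linarith, by linarith⟩
  rw [birkhoff, birkhoff, ← Finset.sum_sub_distrib]
  refine (Finset.abs_sum_le_sum_abs _ _).trans ?_
  have key : ∀ i ∈ Finset.range n, |φ ((shift A)^[i] y) - φ ((shift A)^[i] x)|
      ≤ ε + (if n < i + N then 2 * C else 0) := by
    intro i _
    split_ifs with h
    · linarith [hd ((shift A)^[i] y) ((shift A)^[i] x)]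
    · rw [add_zero]
      exact hN _ _ (shift_iterate_mem_cyl hy (by omega))
  refine (Finset.sum_le_sum key).trans ?_
  rw [Finset.sum_add_distrib, Finset.sum_const, Finset.card_range, nsmul_eq_mul,
    ← Finset.sum_filter, Finset.sum_const, nsmul_eq_mul]
  gcongr
  have : (Finset.range n).filter (fun i => n < i + N) ⊆ Finset.Ico (n - N) n := by
    intro i
    simp only [Finset.mem_filter, Finset.mem_range, Finset.mem_Ico]
    omega
  refine (Finset.card_le_card this).trans ?_
  rw [Nat.card_Ico]
  omega

/-- The set of points whose initial word is `w`. -/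
def wordFiber (A : S → S → Prop) {n : ℕ} (w : Fin n → S) : Set (Space A) :=
  {x | ∀ i : Fin n, x.1 i = w i}

lemma wordFiber_eq_cyl {n : ℕ} {w : Fin n → S} {x : Space A} (hx : x ∈ wordFiber A w) :
    wordFiber A w = cyl x n := by
  ext y
  exact ⟨fun hy i hi => (hy ⟨i, hi⟩).trans (hx ⟨i, hi⟩).symm,
    fun hy i => (hy i i.2).trans (hx i)⟩

lemma pairwise_disjoint_wordFiber (n : ℕ) :
    Pairwise (Function.onFun Disjoint fun w : Fin n → S => wordFiber A w) := by
  intro v w hvw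
  rw [Function.onFun, Set.disjoint_left]
  intro x hv hw
  exact hvw (funext fun i => (hv i).symm.trans (hw i))

lemma iUnion_wordFiber (n : ℕ) : ⋃ w : Fin n → S, wordFiber A w = Set.univ :=
  Set.eq_univ_of_forall fun x => Set.mem_iUnion.2 ⟨fun i => x.1 i, fun _ => rfl⟩

variable [TopologicalSpace S]

section Gibbs

variable {φ : Space A → ℝ} {ν : Measure (Space A)} {c₀ P : ℝ}

lemma IsGibbsWith.real_cyl_pos (h : IsGibbsWith A φ ν c₀ P) (hc : 1 ≤ c₀) {n : ℕ} (hn : 1 ≤ n)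
    (x : Space A) : 0 < ν.real (cyl x n) := by
  have := (h n hn x).1
  rw [cylinder_word] at this
  exact lt_of_lt_of_le (by positivity) this

lemma IsGibbsWith.log_le (h : IsGibbsWith A φ ν c₀ P) (hc : 1 ≤ c₀) {n : ℕ} (hn : 1 ≤ n)
    (x : Space A) :
    Real.log (ν.real (cyl x n)) ≤ Real.log c₀ + (birkhoff (shift A) φ n x - P * n) := by
  have h2 := (h n hn x).2
  rw [cylinder_word, ← measureReal_def] at h2
  have := Real.log_le_log (h.real_cyl_pos hc hn x) h2
  rw [Real.log_mul (by positivity) (by positivity), Real.log_exp] at this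
  linarith

lemma IsGibbsWith.le_log (h : IsGibbsWith A φ ν c₀ P) (hc : 1 ≤ c₀) {n : ℕ} (hn : 1 ≤ n)
    (x : Space A) :
    birkhoff (shift A) φ n x - P * n ≤ Real.log c₀ + Real.log (ν.real (cyl x n)) := by
  have h2 := (h n hn x).1
  rw [cylinder_word, ← measureReal_def] at h2
  have := Real.log_le_log (by positivity) h2
  rw [Real.log_mul (by positivity) (by positivity), Real.log_exp, Real.log_inv] at this
  linarith

end Gibbs

lemma dependsOnFirst_real_cyl (μ : Measure (Space A)) (n : ℕ) :
    DependsOnFirst n fun x : Space A => μ.real (cyl x n) :=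
  fun x y h => by simp only [cyl_eq_of_mem h]

variable [DiscreteTopology S]

lemma measurable_real_cyl (μ : Measure (Space A)) (n : ℕ) :
    Measurable fun x : Space A => μ.real (cyl x n) :=
  (dependsOnFirst_real_cyl μ n).measurable

lemma measurableSet_wordFiber {n : ℕ} (w : Fin n → S) : MeasurableSet (wordFiber A w) := by
  rcases (wordFiber A w).eq_empty_or_nonempty with h | ⟨x, hx⟩
  · rw [h]; exact MeasurableSet.empty
  · rw [wordFiber_eq_cyl hx]; exact measurableSet_cyl x n

variable [Countable S]

lemma lintegral_cyl_ratio_le (μ ν : Measure (Space A)) [IsProbabilityMeasure μ]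
    [IsProbabilityMeasure ν] (n : ℕ) :
    ∫⁻ x, ν (cyl x n) / μ (cyl x n) ∂μ ≤ 1 := by
  calc ∫⁻ x, ν (cyl x n) / μ (cyl x n) ∂μ
      = ∫⁻ x in ⋃ w : Fin n → S, wordFiber A w, ν (cyl x n) / μ (cyl x n) ∂μ := by
        rw [iUnion_wordFiber, Measure.restrict_univ]
    _ ≤ ∑' w : Fin n → S, ∫⁻ x in wordFiber A w, ν (cyl x n) / μ (cyl x n) ∂μ :=
        lintegral_iUnion_le _ _
    _ ≤ ∑' w : Fin n → S, ν (wordFiber A w) := by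
        refine ENNReal.tsum_le_tsum fun w => ?_
        calc ∫⁻ x in wordFiber A w, ν (cyl x n) / μ (cyl x n) ∂μ
            = ∫⁻ _ in wordFiber A w, ν (wordFiber A w) / μ (wordFiber A w) ∂μ :=
              setLIntegral_congr_fun (measurableSet_wordFiber w) fun x hx => by
                simp only [wordFiber_eq_cyl hx]
          _ = ν (wordFiber A w) / μ (wordFiber A w) * μ (wordFiber A w) := by
              rw [setLIntegral_const]
          _ ≤ ν (wordFiber A w) := by
              rw [mul_comm]; exact ENNReal.mul_div_le
    _ = 1 := by
        rw [← measure_iUnion (pairwise_disjoint_wordFiber n) measurableSet_wordFiber,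
          iUnion_wordFiber, measure_univ]

lemma integrable_cyl_ratio (μ ν : Measure (Space A)) [IsProbabilityMeasure μ]
    [IsProbabilityMeasure ν] (n : ℕ) :
    Integrable (fun x => ν.real (cyl x n) / μ.real (cyl x n)) μ ∧
      ∫ x, ν.real (cyl x n) / μ.real (cyl x n) ∂μ ≤ 1 := by
  have hm : Measurable fun x : Space A => ν.real (cyl x n) / μ.real (cyl x n) :=
    (measurable_real_cyl ν n).div (measurable_real_cyl μ n)
  have h0 : ∀ x : Space A, 0 ≤ ν.real (cyl x n) / μ.real (cyl x n) := fun x => by positivity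
  have hle : ∫⁻ x, ENNReal.ofReal (ν.real (cyl x n) / μ.real (cyl x n)) ∂μ ≤ 1 := by
    refine (lintegral_mono fun x => ?_).trans (lintegral_cyl_ratio_le μ ν n)
    rw [measureReal_def, measureReal_def, ← ENNReal.toReal_div]
    exact ENNReal.ofReal_toReal_le
  constructor
  · refine ⟨hm.aestronglyMeasurable, ?_⟩
    rw [hasFiniteIntegral_iff_ofReal (Filter.Eventually.of_forall h0)]
    exact hle.trans_lt ENNReal.one_lt_top
  · rw [integral_eq_lintegral_of_nonneg_ae (Filter.Eventually.of_forall h0)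
      hm.aestronglyMeasurable]
    simpa using ENNReal.toReal_mono ENNReal.one_ne_top hle

end Shift

end CMS

namespace CMS

section Entropy

variable {S : Type*} {A : S → S → Prop} [TopologicalSpace S]

lemma ae_real_cyl_pos [Countable S] (μ : Measure (Space A)) [IsProbabilityMeasure μ] (n : ℕ) :
    ∀ᵐ x ∂μ, 0 < μ.real (cyl x n) := by
  have hsub : {x : Space A | ¬ 0 < μ.real (cyl x n)} ⊆
      ⋃ w : {w : Fin n → S // μ (wordFiber A w) = 0}, wordFiber A w.1 := by
    intro x hx
    have hw : x ∈ wordFiber A fun i : Fin n => x.1 i := fun _ => rfl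
    refine Set.mem_iUnion.2 ⟨⟨fun i => x.1 i, ?_⟩, hw⟩
    rw [wordFiber_eq_cyl hw]
    have : μ.real (cyl x n) = 0 := le_antisymm (not_lt.1 hx) measureReal_nonneg
    exact (measureReal_eq_zero_iff).1 this
  rw [ae_iff]
  exact measure_mono_null hsub (measure_iUnion_null fun w => w.2)

variable [DiscreteTopology S]

lemma exists_dependsOnFirst_approx (μ : Measure (Space A)) [IsProbabilityMeasure μ]
    {p : Space A → ℕ} (hp : Measurable p) (hfin : (Set.range p).Finite) {ε : ℝ} (hε : 0 < ε) :
    ∃ (k : ℕ) (p' : Space A → ℕ), DependsOnFirst k p' ∧ μ.real {x | p x ≠ p' x} < ε := by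
  set B := hfin.toFinset with hB
  have hdense := Measure.MeasureDense.of_generateFrom_isSetAlgebra_finite μ
    (isSetAlgebra_cylAlgebra (A := A)) generateFrom_cylAlgebra
  have hε' : 0 < ε / (B.card + 1) := by positivity
  have happ : ∀ b : ℕ, ∃ t ∈ cylAlgebra A,
      μ (symmDiff (p ⁻¹' {b}) t) < ENNReal.ofReal (ε / (B.card + 1)) := fun b =>
    hdense.approx _ (hp (measurableSet_singleton b)) (measure_ne_top μ _) _ hε'
  choose t ht htμ using happ
  choose k hk using ht
  refine ⟨B.sup k, fun x => sInf {b | b ∈ B ∧ x ∈ t b}, fun x y hxy => ?_, ?_⟩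
  · refine congrArg sInf (Set.ext fun b => and_congr_right fun hb => ?_)
    exact iff_of_eq ((hk b).mono (Finset.le_sup hb) x y hxy)
  · have hsub : {x | p x ≠ sInf {b | b ∈ B ∧ x ∈ t b}} ⊆ ⋃ b ∈ B, symmDiff (p ⁻¹' {b}) (t b) := by
      intro x hx
      by_contra hcon
      simp only [Set.mem_iUnion, not_exists, Set.mem_symmDiff, not_or, not_and, not_not] at hcon
      have hpB : p x ∈ B := by simp [hB]
      have : {b | b ∈ B ∧ x ∈ t b} = {p x} := by
        ext b
        simp only [Set.mem_ofPred_eq, Set.mem_singleton_iff]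
        constructor
        · rintro ⟨hb, hxt⟩
          exact ((hcon b hb).2 hxt).symm
        · rintro rfl
          exact ⟨hpB, (hcon _ hpB).1 rfl⟩
      exact hx (by rw [this]; simp)
    calc μ.real {x | p x ≠ sInf {b | b ∈ B ∧ x ∈ t b}}
        ≤ μ.real (⋃ b ∈ B, symmDiff (p ⁻¹' {b}) (t b)) := measureReal_mono hsub (measure_ne_top _ _)
      _ ≤ ∑ b ∈ B, μ.real (symmDiff (p ⁻¹' {b}) (t b)) := measureReal_biUnion_finset_le _ _
      _ ≤ ∑ _b ∈ B, ε / (B.card + 1) :=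
          Finset.sum_le_sum fun b _ => (ENNReal.toReal_lt_of_lt_ofReal (htμ b)).le
      _ < ε := by
          rw [Finset.sum_const, nsmul_eq_mul, ← mul_div_assoc, div_lt_iff₀ (by positivity)]
          nlinarith

variable [Countable S]

lemma partitionEntropy_le_of_kernel (μ : Measure (Space A)) [IsProbabilityMeasure μ]
    (hinv : Invariant (shift A) μ) {p p' : Space A → ℕ} (hp : Measurable p) {k : ℕ}
    (hp' : DependsOnFirst k p') {B : Finset ℕ} (hB : ∀ x, p x ∈ B) {κ : ℕ → ℕ → ℝ}
    (hκ0 : ∀ b b', 0 < κ b b') (hκ1 : ∀ b', ∑ b ∈ B, κ b b' ≤ 1)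
    (hu : Integrable (fun x => -Real.log (κ (p x) (p' x))) μ) (n : ℕ)
    (hI : Integrable (fun x => -Real.log (μ.real (cyl x (n + k)))) μ) :
    partitionEntropy μ (fun x => fun i : Fin n => p ((shift A)^[i] x)) ≤
      ENNReal.ofReal (∫ x, -Real.log (μ.real (cyl x (n + k))) ∂μ
        + n * ∫ x, -Real.log (κ (p x) (p' x)) ∂μ) := by
  classical
  have hT : MeasurePreserving (shift A) μ μ := hinv.measurePreserving measurable_shift
  set g : Space A → Fin n → ℕ := fun x i => p ((shift A)^[i] x) with hg
  have hgm : Measurable g := measurable_pi_lambda _ fun i => hp.comp (hT.measurable.iterate i)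
  set Z : Finset (Fin n → ℕ) := Fintype.piFinset fun _ => B with hZ
  have hgZ : ∀ x, g x ∈ Z := fun x => Fintype.mem_piFinset.2 fun i => hB _
  set q : (Fin n → ℕ) → ℝ := fun z => μ.real (g ⁻¹' {z}) with hq
  set W : (Fin n → ℕ) → Space A → ℝ := fun z y => ∏ i, κ (z i) (p' ((shift A)^[i] y)) with hW
  have hWdep : ∀ z, DependsOnFirst (n + k) (W z) := fun z x y h => by
    refine Finset.prod_congr rfl fun i _ => ?_
    rw [hp' _ _ (shift_iterate_mem_cyl h (by omega) :
      (shift A)^[i] y ∈ cyl ((shift A)^[i] x) k)]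
  have hWpos : ∀ z y, 0 < W z y := fun z y => Finset.prod_pos fun i _ => hκ0 _ _
  have hWsum : ∀ y, ∑ z ∈ Z, W z y ≤ 1 := fun y => by
    rw [hZ, ← Finset.prod_univ_sum (fun _ => B) fun (i : Fin n) b => κ b (p' ((shift A)^[i] y))]
    exact Finset.prod_le_one (fun i _ => Finset.sum_nonneg fun b _ => (hκ0 _ _).le)
      fun i _ => hκ1 _
  have hWint : ∀ z ∈ Z, Integrable (W z) μ := fun z hz => by
    refine Integrable.of_bound (hWdep z).measurable.aestronglyMeasurable 1
      (Filter.Eventually.of_forall fun y => ?_)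
    rw [Real.norm_of_nonneg (hWpos z y).le]
    exact (Finset.single_le_sum (f := fun z => W z y) (fun z _ => (hWpos z y).le) hz).trans
      (hWsum y)
  set R : (Fin n → ℕ) → ℝ := fun z => ∫ y, W z y ∂μ with hR
  have hRpos : ∀ z ∈ Z, 0 < R z := fun z hz => by
    rw [hR]
    simp only
    rw [integral_pos_iff_support_of_nonneg (fun y => (hWpos z y).le) (hWint z hz)]
    have : Function.support (W z) = Set.univ :=
      Set.eq_univ_of_forall fun y => (hWpos z y).ne'
    rw [this]
    simp
  have hRsum : ∑ z ∈ Z, R z ≤ 1 := by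
    rw [hR]
    simp only
    rw [← integral_finsetSum _ hWint]
    calc ∫ y, ∑ z ∈ Z, W z y ∂μ ≤ ∫ _y, (1 : ℝ) ∂μ :=
          integral_mono (integrable_finsetSum _ hWint) (integrable_const _) hWsum
      _ = 1 := by simp
  have hsumint : ∀ c : (Fin n → ℕ) → ℝ, Integrable (fun x => c (g x)) μ ∧
      ∫ x, c (g x) ∂μ = ∑ z ∈ Z, q z * c z := fun c => by
    have he : (fun x => c (g x)) =
        fun x => ∑ z ∈ Z, (g ⁻¹' {z}).indicator (fun _ => c z) x := by
      funext x
      rw [Finset.sum_eq_single (g x)]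
      · simp
      · intro z _ hz
        exact Set.indicator_of_notMem (fun h => hz (Eq.symm h)) _
      · exact fun h => (h (hgZ x)).elim
    have hi : ∀ z ∈ Z, Integrable ((g ⁻¹' {z}).indicator fun _ => c z) μ := fun z _ =>
      (integrable_const _).indicator (hgm (measurableSet_singleton z))
    rw [he]
    refine ⟨integrable_finsetSum _ hi, ?_⟩
    rw [integral_finsetSum _ hi]
    refine Finset.sum_congr rfl fun z _ => ?_
    rw [integral_indicator (hgm (measurableSet_singleton z)), setIntegral_const, smul_eq_mul]
  have hqsum : ∑ z ∈ Z, q z = 1 := by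
    have := (hsumint fun _ => 1).2
    simpa using this.symm
  have hent : partitionEntropy μ g = ENNReal.ofReal (∑ z ∈ Z, -(q z * Real.log (q z))) := by
    have hnn : ∀ z ∈ Z, 0 ≤ -(q z * Real.log (q z)) := fun z _ => by
      have := Real.mul_log_nonpos (x := q z) measureReal_nonneg measureReal_le_one
      linarith
    rw [ENNReal.ofReal_sum_of_nonneg hnn]
    refine tsum_eq_sum fun z hz => ?_
    have : g ⁻¹' {z} = ∅ := Set.eq_empty_of_forall_notMem fun x hx => hz (by
      rw [← (show g x = z from hx)]; exact hgZ x)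
    simp [this]
  rw [hent]
  apply ENNReal.ofReal_le_ofReal
  have hgibbs : ∑ z ∈ Z, -(q z * Real.log (q z)) ≤ ∑ z ∈ Z, q z * -Real.log (R z) := by
    have hterm : ∀ z ∈ Z, -(q z * Real.log (q z)) ≤ q z * -Real.log (R z) + (R z - q z) := by
      intro z hz
      have hq0 : 0 ≤ q z := measureReal_nonneg
      rcases hq0.eq_or_lt with h | h
      · rw [← h]; simpa using (hRpos z hz).le
      · have h1 := Real.log_le_sub_one_of_pos (div_pos (hRpos z hz) h)
        rw [Real.log_div (hRpos z hz).ne' h.ne'] at h1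
        have h2 := mul_le_mul_of_nonneg_left h1 h.le
        rw [mul_sub, mul_sub, mul_div_cancel₀ _ h.ne'] at h2
        linarith
    have := Finset.sum_le_sum hterm
    rw [Finset.sum_add_distrib, Finset.sum_sub_distrib, hqsum] at this
    linarith
  refine hgibbs.trans ?_
  rw [← (hsumint fun z => -Real.log (R z)).2, ← integral_birkhoff hT hu n,
    ← integral_add hI (integrable_birkhoff hT hu n)]
  refine integral_mono_ae (hsumint fun z => -Real.log (R z)).1
    (hI.add (integrable_birkhoff hT hu n)) ?_
  filter_upwards [ae_real_cyl_pos μ (n + k)] with x hx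
  have hRge : μ.real (cyl x (n + k)) * W (g x) x ≤ R (g x) := by
    calc μ.real (cyl x (n + k)) * W (g x) x
        = ∫ y in cyl x (n + k), W (g x) y ∂μ := by
          rw [setIntegral_congr_fun (measurableSet_cyl x _)
            (g := fun _ => W (g x) x) fun y hy => hWdep (g x) x y hy,
            setIntegral_const, smul_eq_mul]
      _ ≤ R (g x) := setIntegral_le_integral (hWint _ (hgZ x))
          (Filter.Eventually.of_forall fun y => (hWpos _ y).le)
  have hlog := Real.log_le_log (mul_pos hx (hWpos _ _)) hRge
  rw [Real.log_mul hx.ne' (hWpos _ _).ne'] at hlog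
  have hWlog : Real.log (W (g x) x) =
      -birkhoff (shift A) (fun x => -Real.log (κ (p x) (p' x))) n x := by
    rw [hW]
    simp only
    rw [Real.log_prod fun i _ => (hκ0 _ _).ne', birkhoff, Finset.sum_neg_distrib, neg_neg,
      ← Fin.sum_univ_eq_sum_range
        fun i => Real.log (κ (p ((shift A)^[i] x)) (p' ((shift A)^[i] x)))]
  linarith

lemma exists_partitionEntropy_le (μ : Measure (Space A)) [IsProbabilityMeasure μ]
    (hinv : Invariant (shift A) μ) {p : Space A → ℕ} (hp : Measurable p)
    (hfin : (Set.range p).Finite) {ε : ℝ} (hε : 0 < ε) :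
    ∃ k : ℕ, ∀ n : ℕ, Integrable (fun x => -Real.log (μ.real (cyl x (n + k)))) μ →
      partitionEntropy μ (fun x => fun i : Fin n => p ((shift A)^[i] x)) ≤
        ENNReal.ofReal (∫ x, -Real.log (μ.real (cyl x (n + k))) ∂μ + n * ε) := by
  classical
  set B := hfin.toFinset with hBdef
  have hB : ∀ x, p x ∈ B := fun x => by simp [hBdef]
  obtain ⟨x₀⟩ : Nonempty (Space A) := nonempty_of_isProbabilityMeasure μ
  have hBc : 0 < (B.card : ℝ) := by exact_mod_cast Finset.card_pos.2 ⟨_, hB x₀⟩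
  set δ : ℝ := 1 - Real.exp (-(ε / 2)) with hδ
  have hδ1 : δ < 1 := by have := Real.exp_pos (-(ε / 2)); linarith
  have hδ0 : 0 < δ := by
    have : Real.exp (-(ε / 2)) < 1 := by
      rw [Real.exp_lt_one_iff]; linarith
    linarith
  have h1δ : -Real.log (1 - δ) = ε / 2 := by simp [hδ]
  set c : ℝ := -Real.log (δ / B.card) with hc
  have hc0 : 0 ≤ c := by
    have hle : δ / B.card ≤ 1 := by
      rw [div_le_one hBc]
      have : (1 : ℝ) ≤ B.card := by exact_mod_cast Finset.card_pos.2 ⟨_, hB x₀⟩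
      linarith
    have := Real.log_nonpos (by positivity) hle
    linarith
  obtain ⟨k, p', hp', hμ⟩ := exists_dependsOnFirst_approx μ hp hfin
    (show 0 < ε / (2 * (c + 1)) by positivity)
  set κ : ℕ → ℕ → ℝ := fun b b' => δ / B.card + if b = b' then 1 - δ else 0 with hκ
  have hκge : ∀ b b', δ / B.card ≤ κ b b' := fun b b' => by
    simp only [hκ]
    split_ifs <;> linarith
  have hκ0 : ∀ b b', 0 < κ b b' := fun b b' => lt_of_lt_of_le (by positivity) (hκge b b')
  have hκ1 : ∀ b', ∑ b ∈ B, κ b b' ≤ 1 := fun b' => by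
    simp only [hκ]
    rw [Finset.sum_add_distrib, Finset.sum_const, nsmul_eq_mul, mul_div_cancel₀ _ hBc.ne',
      Finset.sum_ite_eq']
    split_ifs <;> linarith
  have hκle : ∀ x, κ (p x) (p' x) ≤ 1 := fun x =>
    (Finset.single_le_sum (f := fun b => κ b (p' x)) (fun b _ => (hκ0 _ _).le) (hB x)).trans
      (hκ1 _)
  have hκdiag : ∀ b, 1 - δ ≤ κ b b := fun b => by
    simp only [hκ, if_true]
    have : 0 < δ / B.card := by positivity
    linarith
  have hne : MeasurableSet {x | p x ≠ p' x} := (measurableSet_eq_fun hp hp'.measurable).compl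
  have hupper : ∀ x, -Real.log (κ (p x) (p' x)) ≤
      ε / 2 + {x | p x ≠ p' x}.indicator (fun _ => c) x := fun x => by
    by_cases h : p x = p' x
    · rw [Set.indicator_of_notMem (by simpa using h), ← h, add_zero, ← h1δ]
      have := Real.log_le_log (by linarith) (hκdiag (p x))
      linarith
    · rw [Set.indicator_of_mem (by simpa using h)]
      have := Real.log_le_log (by positivity) (hκge (p x) (p' x))
      linarith
  have hlower : ∀ x, 0 ≤ -Real.log (κ (p x) (p' x)) := fun x => by
    have := Real.log_nonpos (hκ0 _ _).le (hκle x)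
    linarith
  have hφint : Integrable (fun x => ε / 2 + {x | p x ≠ p' x}.indicator (fun _ => c) x) μ :=
    (integrable_const _).add ((integrable_const _).indicator hne)
  have hum : Measurable fun x => -Real.log (κ (p x) (p' x)) :=
    (Measurable.of_discrete (f := fun z : ℕ × ℕ => -Real.log (κ z.1 z.2))).comp
      (hp.prodMk hp'.measurable)
  have hu : Integrable (fun x => -Real.log (κ (p x) (p' x))) μ :=
    hφint.mono' hum.aestronglyMeasurable (Filter.Eventually.of_forall fun x => by
      rw [Real.norm_of_nonneg (hlower x)]; exact hupper x)
  have huint : ∫ x, -Real.log (κ (p x) (p' x)) ∂μ ≤ ε := by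
    refine (integral_mono hu hφint hupper).trans ?_
    rw [integral_add (integrable_const _) ((integrable_const _).indicator hne),
      integral_indicator hne, setIntegral_const]
    simp only [integral_const, probReal_univ, smul_eq_mul, one_mul]
    have : μ.real {x | p x ≠ p' x} * c ≤ ε / 2 := by
      have h1 : μ.real {x | p x ≠ p' x} * c ≤ ε / (2 * (c + 1)) * (c + 1) :=
        mul_le_mul hμ.le (by linarith) hc0 (by positivity)
      have h2 : ε / (2 * (c + 1)) * (c + 1) = ε / 2 := by field_simp
      linarith
    linarith
  refine ⟨k, fun n hI => (partitionEntropy_le_of_kernel μ hinv hp hp' hB hκ0 hκ1 hu n hI).trans ?_⟩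
  apply ENNReal.ofReal_le_ofReal
  gcongr

end Entropy

end CMS

namespace CMS

section Blocks

variable {S : Type*} {A : S → S → Prop}

lemma exists_uniform_bound {ι : Type*} [Fintype ι] {φs : ι → Space A → ℝ}
    (h : ∀ j, Bdd A (φs j)) : ∃ C : ℝ, 0 ≤ C ∧ ∀ j x, |φs j x| ≤ C := by
  choose C hC using h
  refine ⟨∑ j, |C j|, Finset.sum_nonneg fun j _ => abs_nonneg _, fun j x => ?_⟩
  exact ((hC j x).trans (le_abs_self _)).trans
    (Finset.single_le_sum (f := fun j => |C j|) (fun j _ => abs_nonneg _) (Finset.mem_univ j))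

lemma exists_uniform_variation {ι : Type*} [Fintype ι] {φs : ι → Space A → ℝ}
    (h : ∀ j, UnifCont A (φs j) ∧ Bdd A (φs j)) {ε : ℝ} (hε : 0 < ε) :
    ∃ D : ℝ, 0 ≤ D ∧ ∀ (j : ι) (n : ℕ) (x y : Space A), y ∈ cyl x n →
      |birkhoff (shift A) (φs j) n y - birkhoff (shift A) (φs j) n x| ≤ n * ε + D := by
  choose D hD0 hD using fun j => exists_birkhoff_variation (h j).1 (h j).2 hε
  refine ⟨∑ j, D j, Finset.sum_nonneg fun j _ => hD0 j, fun j n x y hxy => ?_⟩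
  have := Finset.single_le_sum (f := D) (fun j _ => hD0 j) (Finset.mem_univ j)
  linarith [hD j n x y hxy]

lemma div_sub_le_of_half {g Y M : ℝ} (hg : 1 / 2 ≤ g) (hg1 : g ≤ 1) (hY : |Y| ≤ M) :
    Y - 2 * (1 - g) * M ≤ Y / g := by
  have hg0 : 0 < g := by linarith
  rw [le_div_iff₀ hg0]
  have h := abs_le.1 hY
  have hM : 0 ≤ M := (abs_nonneg _).trans hY
  nlinarith [mul_nonneg (sub_nonneg.2 hg1) (by linarith : 0 ≤ M - Y),
    mul_nonneg (mul_nonneg (sub_nonneg.2 hg1) hM) (by linarith : 0 ≤ 2 * g - 1)]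

variable [TopologicalSpace S]

/-- The logarithm of the ratio of the `ν`- and `μ`-masses of the `n`-cylinder of a point. -/
noncomputable def logRatio (μ ν : Measure (Space A)) (n : ℕ) (x : Space A) : ℝ :=
  Real.log (ν.real (cyl x n) / μ.real (cyl x n))

lemma dependsOnFirst_logRatio (μ ν : Measure (Space A)) (n : ℕ) :
    DependsOnFirst n (logRatio μ ν n) :=
  fun x y h => by simp only [logRatio, cyl_eq_of_mem h]

variable {φ : Space A → ℝ} {μ ν : Measure (Space A)} {c₀ P : ℝ}

lemma integrable_potential (hc : 1 ≤ c₀) [IsProbabilityMeasure μ] [IsProbabilityMeasure ν]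
    (hG : IsGibbsWith A φ ν c₀ P) (hφ : Measurable φ) (hbot : IntegralGtBot φ μ) :
    Integrable φ μ := by
  have hub : ∀ x, φ x ≤ P + Real.log c₀ := fun x => by
    have h1 := hG.le_log hc le_rfl x
    have h2 := Real.log_nonpos measureReal_nonneg (measureReal_le_one (μ := ν) (s := cyl x 1))
    simp [birkhoff] at h1
    linarith
  have hneg : Integrable (fun x => max (-φ x) 0) μ := by
    refine ⟨(hφ.neg.max measurable_const).aestronglyMeasurable, ?_⟩
    rw [hasFiniteIntegral_iff_ofReal (f := fun x => max (-φ x) 0)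
      (Filter.Eventually.of_forall fun x => le_max_right (-φ x) 0)]
    refine lt_of_le_of_lt (le_of_eq (lintegral_congr fun x => ?_)) (lt_top_iff_ne_top.2 hbot)
    rcases le_total (-φ x) 0 with h | h
    · rw [max_eq_right h, ENNReal.ofReal_zero, ENNReal.ofReal_of_nonpos h]
    · rw [max_eq_left h]
  refine ((integrable_const |P + Real.log c₀|).add hneg).mono' hφ.aestronglyMeasurable
    (Filter.Eventually.of_forall fun x => ?_)
  rw [Real.norm_eq_abs, abs_le, Pi.add_apply]
  have h1 := le_max_left (-φ x) 0
  have h2 := le_max_right (-φ x) 0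
  have h3 := abs_nonneg (P + Real.log c₀)
  exact ⟨by linarith, by linarith [hub x, le_abs_self (P + Real.log c₀)]⟩

lemma logRatio_bounds [IsProbabilityMeasure μ] [IsProbabilityMeasure ν]
    (n : ℕ) (x : Space A) (hpos : 0 < ν.real (cyl x n)) :
    Real.log (ν.real (cyl x n)) + -Real.log (μ.real (cyl x n)) ≤ logRatio μ ν n x ∧
      logRatio μ ν n x ≤ ν.real (cyl x n) / μ.real (cyl x n) := by
  refine ⟨?_, Real.log_le_self (by positivity)⟩
  rcases (measureReal_nonneg (μ := μ) (s := cyl x n)).eq_or_lt with h | h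
  · simp only [logRatio, ← h, div_zero, Real.log_zero]
    have := Real.log_nonpos hpos.le (measureReal_le_one (μ := ν) (s := cyl x n))
    linarith
  · rw [logRatio, Real.log_div hpos.ne' h.ne']
    linarith

variable [DiscreteTopology S] [Countable S]

lemma integrable_logRatio (hc : 1 ≤ c₀) [IsProbabilityMeasure μ] [IsProbabilityMeasure ν]
    (hG : IsGibbsWith A φ ν c₀ P) (hinv : Invariant (shift A) μ) (hφ : Integrable φ μ) {n : ℕ}
    (hn : 1 ≤ n) :
    Integrable (fun x => -Real.log (μ.real (cyl x n))) μ ∧ Integrable (logRatio μ ν n) μ ∧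
      n * (∫ x, φ x ∂μ) - P * n - Real.log c₀ + ∫ x, -Real.log (μ.real (cyl x n)) ∂μ ≤
        ∫ x, logRatio μ ν n x ∂μ := by
  have hT : MeasurePreserving (shift A) μ μ := hinv.measurePreserving measurable_shift
  have hS := integrable_birkhoff hT hφ n
  have hlb : ∀ x, birkhoff (shift A) φ n x - P * n - Real.log c₀ ≤ Real.log (ν.real (cyl x n)) :=
    fun x => by linarith [hG.le_log hc hn x]
  have hb := fun x => logRatio_bounds (μ := μ) (ν := ν) n x (hG.real_cyl_pos hc hn x)
  have hSc : Integrable (fun x => birkhoff (shift A) φ n x - P * n - Real.log c₀) μ :=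
    (hS.sub (integrable_const _)).sub (integrable_const _)
  have hr := (integrable_cyl_ratio μ ν n).1
  have hI0 : ∀ x : Space A, 0 ≤ -Real.log (μ.real (cyl x n)) := fun x => by
    have := Real.log_nonpos measureReal_nonneg (measureReal_le_one (μ := μ) (s := cyl x n))
    linarith
  have hI : Integrable (fun x => -Real.log (μ.real (cyl x n))) μ := by
    refine (hr.sub hSc).mono'
      (Real.measurable_log.comp (measurable_real_cyl μ n)).neg.aestronglyMeasurable
      (Filter.Eventually.of_forall fun x => ?_)
    rw [Real.norm_of_nonneg (hI0 x), Pi.sub_apply]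
    linarith [(hb x).1, (hb x).2, hlb x]
  have hJ : Integrable (logRatio μ ν n) μ := by
    refine (hr.abs.add hSc.abs).mono'
      (dependsOnFirst_logRatio μ ν n).measurable.aestronglyMeasurable
      (Filter.Eventually.of_forall fun x => ?_)
    rw [Real.norm_eq_abs, Pi.add_apply, abs_le]
    have h1 := neg_abs_le (birkhoff (shift A) φ n x - P * n - Real.log c₀)
    have h2 := le_abs_self (ν.real (cyl x n) / μ.real (cyl x n))
    have h3 := abs_nonneg (birkhoff (shift A) φ n x - P * n - Real.log c₀)
    have h4 := abs_nonneg (ν.real (cyl x n) / μ.real (cyl x n))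
    exact ⟨by linarith [(hb x).1, hI0 x, hlb x], by linarith [(hb x).2]⟩
  refine ⟨hI, hJ, ?_⟩
  have heq : n * (∫ x, φ x ∂μ) - P * n - Real.log c₀ =
      ∫ x, (birkhoff (shift A) φ n x - P * n - Real.log c₀) ∂μ := by
    have hS' : Integrable (fun x => birkhoff (shift A) φ n x - P * n) μ :=
      hS.sub (integrable_const _)
    rw [integral_sub hS' (integrable_const _),
      integral_sub hS (integrable_const _), integral_birkhoff hT hφ]
    simp
  rw [heq, ← integral_add hSc hI]
  exact integral_mono (hSc.add hI) hJ fun x => by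
    simp only
    linarith [(hb x).1, hlb x]

lemma exists_partition_of_lt_entropy {X : Type*} [MeasurableSpace X] {T : X → X} {μ : Measure X}
    {h : ℝ} (hlt : (h : EReal) < ((entropy T μ : ℝ≥0∞) : EReal)) :
    ∃ p : X → ℕ, Measurable p ∧ (Set.range p).Finite ∧ ∀ᶠ n : ℕ in atTop,
      ENNReal.ofReal (n * h) ≤ partitionEntropy μ (fun x => fun i : Fin n => p (T^[i] x)) := by
  rcases lt_or_ge h 0 with h0 | h0
  · refine ⟨fun _ => 0, measurable_const, (Set.finite_singleton 0).subset (by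
      rintro _ ⟨x, rfl⟩; rfl), Filter.Eventually.of_forall fun n => ?_⟩
    rw [ENNReal.ofReal_of_nonpos (mul_nonpos_of_nonneg_of_nonpos n.cast_nonneg h0.le)]
    exact bot_le
  · have hlt' : ENNReal.ofReal h < entropy T μ := by
      rw [← EReal.coe_ennreal_lt_coe_ennreal_iff, EReal.coe_ennreal_ofReal, max_eq_left h0]
      exact hlt
    rw [entropy, lt_iSup_iff] at hlt'
    obtain ⟨p, hp⟩ := hlt'
    rw [lt_iSup_iff] at hp
    obtain ⟨⟨hpm, hpf⟩, hp⟩ := hp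
    refine ⟨p, hpm, hpf, ?_⟩
    filter_upwards [eventually_lt_of_lt_liminf hp, eventually_gt_atTop 0] with n hn hn0
    have hn0' : (0 : ℝ) < n := by exact_mod_cast hn0
    rw [ENNReal.ofReal_mul hn0'.le]
    calc ENNReal.ofReal n * ENNReal.ofReal h
        ≤ ENNReal.ofReal n * (ENNReal.ofReal ((n : ℝ)⁻¹) *
            partitionEntropy μ (fun x => fun i : Fin n => p (T^[i] x))) := by gcongr
      _ = partitionEntropy μ (fun x => fun i : Fin n => p (T^[i] x)) := by
          rw [← mul_assoc, ← ENNReal.ofReal_mul hn0'.le, mul_inv_cancel₀ hn0'.ne',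
            ENNReal.ofReal_one, one_mul]

lemma eventually_le_integral_logRatio (hc : 1 ≤ c₀) [IsProbabilityMeasure ν]
    (hG : IsGibbsWith A φ ν c₀ P) (hφ : Measurable φ) {m : ProbabilityMeasure (Space A)} {s : ℝ}
    (hs : (s : EReal) < freeEnergy (shift A) φ P m) :
    Invariant (shift A) (m : Measure (Space A)) ∧ Integrable φ (m : Measure (Space A)) ∧
    ∀ᶠ n : ℕ in atTop, n * s ≤ ∫ x, logRatio (m : Measure (Space A)) ν n x ∂m := by
  rw [freeEnergy] at hs
  split_ifs at hs with hcond
  swap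
  · exact (not_lt_bot hs).elim
  obtain ⟨hinv, hbot⟩ := hcond
  have hφint : Integrable φ (m : Measure (Space A)) := integrable_potential hc hG hφ hbot
  refine ⟨hinv, hφint, ?_⟩
  set I := ∫ x, φ x ∂(m : Measure (Space A)) with hIdef
  have heint : eintegral φ (m : Measure (Space A)) = ((I : ℝ) : EReal) := by
    have hpos : ∫⁻ x, ENNReal.ofReal (φ x) ∂(m : Measure (Space A)) ≠ ⊤ :=
      (hφint.lintegral_lt_top).ne
    rw [eintegral, hIdef, integral_eq_lintegral_pos_part_sub_lintegral_neg_part hφint,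
      EReal.coe_sub, EReal.coe_ennreal_toReal hpos, EReal.coe_ennreal_toReal hbot]
  rw [heint] at hs
  have hent : ((s - I + P : ℝ) : EReal) <
      ((entropy (shift A) (m : Measure (Space A)) : ℝ≥0∞) : EReal) := by
    by_contra hcon
    rw [not_lt] at hcon
    refine absurd hs (not_lt.2 ?_)
    calc ((entropy (shift A) (m : Measure (Space A)) : ℝ≥0∞) : EReal) + (I : EReal) - (P : EReal)
        ≤ ((s - I + P : ℝ) : EReal) + (I : EReal) - (P : EReal) :=
          EReal.sub_le_sub (add_le_add hcon le_rfl) le_rfl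
      _ = (s : EReal) := by
          rw [← EReal.coe_add, ← EReal.coe_sub]
          congr 1
          ring
  obtain ⟨h, hh1, hh2⟩ := EReal.lt_iff_exists_real_btwn.1 hent
  rw [EReal.coe_lt_coe_iff] at hh1
  obtain ⟨p, hpm, hpf, hp⟩ := exists_partition_of_lt_entropy hh2
  set ε : ℝ := (h - (s - I + P)) / 2 with hε
  have hε0 : 0 < ε := by rw [hε]; linarith
  obtain ⟨k, hk⟩ := exists_partitionEntropy_le (m : Measure (Space A)) hinv hpm hpf hε0
  have htend : Tendsto (fun n : ℕ => (n : ℝ) * ε) atTop atTop :=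
    tendsto_natCast_atTop_atTop.atTop_mul_const hε0
  have hp' := (tendsto_sub_atTop_nat k).eventually hp
  filter_upwards [hp', eventually_ge_atTop (k + 1),
    htend.eventually_ge_atTop (k * (h - ε) + Real.log c₀)] with n hn hnk hlarge
  obtain ⟨i, rfl⟩ : ∃ i, n = i + k := ⟨n - k, by omega⟩
  rw [Nat.add_sub_cancel] at hn
  obtain ⟨hI, _, hJ⟩ := integrable_logRatio hc hG hinv hφint (n := i + k) (by omega)
  have hI0 : 0 ≤ ∫ x, -Real.log ((m : Measure (Space A)).real (cyl x (i + k))) ∂m :=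
    integral_nonneg fun x => by
      have := Real.log_nonpos measureReal_nonneg
        (measureReal_le_one (μ := (m : Measure (Space A))) (s := cyl x (i + k)))
      simp only [Pi.zero_apply]
      linarith
  have hle := hn.trans (hk i hI)
  rw [ENNReal.ofReal_le_ofReal_iff (by positivity)] at hle
  push_cast at hJ hlarge ⊢
  have : h = s - I + P + 2 * ε := by rw [hε]; ring
  rw [this] at hle hlarge
  nlinarith

end Blocks

end CMS

namespace CMS

section BlockSelection

variable {S : Type*} {A : S → S → Prop} [TopologicalSpace S] [DiscreteTopology S]

lemma setIntegral_biUnion_cyl {μ : Measure (Space A)} {m : ℕ} {T : Finset (Space A)}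
    (hdist : ∀ t ∈ T, ∀ t' ∈ T, t' ∈ cyl t m → t' = t) {f : Space A → ℝ} (hf : Integrable f μ) :
    ∫ x in ⋃ t ∈ T, cyl t m, f x ∂μ = ∑ t ∈ T, ∫ x in cyl t m, f x ∂μ :=
  integral_biUnion_finset T (fun t _ => measurableSet_cyl t m)
    (fun t ht t' ht' hne => cyl_disjoint fun h => hne (hdist t ht t' ht' h).symm)
    fun _ _ => hf.integrableOn

lemma setIntegral_cyl_of_dependsOnFirst (μ : Measure (Space A)) {m : ℕ} {f : Space A → ℝ}
    (hf : DependsOnFirst m f) (t : Space A) :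
    ∫ x in cyl t m, f x ∂μ = μ.real (cyl t m) * f t := by
  rw [setIntegral_congr_fun (measurableSet_cyl t m) (g := fun _ => f t) fun y hy => hf t y hy,
    setIntegral_const, smul_eq_mul]

variable [Countable S]

lemma exists_finset_words (μ : Measure (Space A)) [IsProbabilityMeasure μ]
    (hinv : Invariant (shift A) μ) {η : ℝ} (hη : 0 < η) :
    ∃ K : Finset S, ∀ m : ℕ, ∃ T : Finset (Space A),
      (∀ t ∈ T, t.1 0 ∈ K ∧ t.1 (m - 1) ∈ K) ∧
      (∀ t ∈ T, ∀ t' ∈ T, t' ∈ cyl t m → t' = t) ∧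
      1 - 3 * η ≤ μ.real (⋃ t ∈ T, cyl t m) := by
  classical
  have hT : MeasurePreserving (shift A) μ μ := hinv.measurePreserving measurable_shift
  have hfib : ∀ s : S, MeasurableSet ((fun x : Space A => x.1 0) ⁻¹' {s}) := fun s =>
    ((isOpen_discrete _).preimage (continuous_coord 0)).measurableSet
  obtain ⟨K, hK⟩ := exists_finset_measure_compl_lt μ hfib hη
  refine ⟨K, fun m => ?_⟩
  have hfib' : ∀ w : Fin m → S, MeasurableSet ((fun (x : Space A) (i : Fin m) => x.1 i) ⁻¹' {w}) :=
    fun w => by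
      convert measurableSet_wordFiber (A := A) w using 1
      ext x
      simp [wordFiber, funext_iff]
  obtain ⟨F, hF⟩ := exists_finset_measure_compl_lt μ hfib' hη
  set F' := F.filter fun w => ∃ x ∈ wordFiber A w, x.1 0 ∈ K ∧ x.1 (m - 1) ∈ K with hF'
  have hex : ∀ w ∈ F', ∃ x ∈ wordFiber A w, x.1 0 ∈ K ∧ x.1 (m - 1) ∈ K := fun w hw =>
    (Finset.mem_filter.1 hw).2
  choose rep hrep hrepK using hex
  refine ⟨F'.attach.image fun w => rep w.1 w.2, ?_, ?_, ?_⟩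
  · intro t ht
    obtain ⟨w, _, rfl⟩ := Finset.mem_image.1 ht
    exact hrepK _ _
  · intro t ht t' ht' hmem
    obtain ⟨w, _, rfl⟩ := Finset.mem_image.1 ht
    obtain ⟨w', _, rfl⟩ := Finset.mem_image.1 ht'
    have : w' = w := Subtype.ext (funext fun i =>
      ((hrep _ w'.2 i).symm.trans (hmem i i.2)).trans (hrep _ w.2 i))
    rw [this]
  · have hsub : (⋃ t ∈ F'.attach.image fun w => rep w.1 w.2, cyl t m)ᶜ ⊆
        {x : Space A | x.1 0 ∉ K} ∪ (shift A)^[m - 1] ⁻¹' {x : Space A | x.1 0 ∉ K} ∪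
          {x : Space A | (fun i : Fin m => x.1 i) ∉ F} := by
      intro x hx
      by_contra hcon
      simp only [Set.mem_union, Set.mem_preimage, Set.mem_ofPred_eq, not_or, not_not,
        shift_iterate_apply, zero_add] at hcon
      obtain ⟨⟨h0, h1⟩, h2⟩ := hcon
      have hwF : (fun i : Fin m => x.1 i) ∈ F' :=
        Finset.mem_filter.2 ⟨h2, x, fun _ => rfl, h0, h1⟩
      refine hx (Set.mem_iUnion₂.2 ⟨rep _ hwF,
        Finset.mem_image.2 ⟨⟨_, hwF⟩, Finset.mem_attach _ _, rfl⟩, fun i hi => ?_⟩)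
      exact (hrep _ hwF ⟨i, hi⟩).symm
    have hKm : MeasurableSet {x : Space A | x.1 0 ∉ K} :=
      ((isOpen_discrete {s : S | s ∉ K}).preimage (continuous_coord 0)).measurableSet
    have hshift : μ.real ((shift A)^[m - 1] ⁻¹' {x : Space A | x.1 0 ∉ K}) < η := by
      rw [measureReal_def, (hT.iterate (m - 1)).measure_preimage hKm.nullMeasurableSet]
      exact hK
    have hle := (measureReal_mono hsub (measure_ne_top μ _)).trans
      ((measureReal_union_le _ _).trans (add_le_add_left (measureReal_union_le _ _) _))
    rw [probReal_compl_eq_one_sub (Finset.measurableSet_biUnion _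
      fun t _ => measurableSet_cyl t m)] at hle
    linarith

/-- A finite family of words of length `m` with endpoints in `K`, together with weights, whose
relative entropy and Birkhoff averages approximate prescribed values. -/
structure IsBlockFamily {ι : Type*} (ν : Measure (Space A)) (φs : ι → Space A → ℝ) (K : Finset S)
    (m : ℕ) (s : ℝ) (I : ι → ℝ) (T : Finset (Space A)) (q : Space A → ℝ) : Prop where
  ends : ∀ t ∈ T, t.1 0 ∈ K ∧ t.1 (m - 1) ∈ K
  eq_of_mem : ∀ t ∈ T, ∀ t' ∈ T, t' ∈ cyl t m → t' = t
  nonneg : ∀ t, 0 ≤ q t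
  sum_eq_one : ∑ t ∈ T, q t = 1
  le_sum_log : m * s ≤ ∑ t ∈ T, q t * Real.log (ν.real (cyl t m) / q t)
  le_sum_birkhoff : ∀ j, m * I j ≤ ∑ t ∈ T, q t * birkhoff (shift A) (φs j) m t

lemma exists_isBlockFamily {ι : Type*} [Fintype ι] {φs : ι → Space A → ℝ}
    (hφs : ∀ j, UnifCont A (φs j) ∧ Bdd A (φs j)) (hφm : ∀ j, Measurable (φs j))
    (μ ν : Measure (Space A)) [IsProbabilityMeasure μ] [IsProbabilityMeasure ν]
    (hinv : Invariant (shift A) μ) (hJi : ∀ᶠ n : ℕ in atTop, Integrable (logRatio μ ν n) μ)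
    (hνpos : ∀ n, 1 ≤ n → ∀ x : Space A, 0 < ν.real (cyl x n))
    {s : ℝ} (hs : ∀ᶠ n : ℕ in atTop, n * s ≤ ∫ x, logRatio μ ν n x ∂μ) {ε : ℝ} (hε : 0 < ε) :
    ∃ K : Finset S, ∀ᶠ m : ℕ in atTop, ∃ (T : Finset (Space A)) (q : Space A → ℝ),
      IsBlockFamily ν φs K m (s - ε) (fun j => (∫ x, φs j x ∂μ) - ε) T q := by
  have hT : MeasurePreserving (shift A) μ μ := hinv.measurePreserving measurable_shift
  obtain ⟨C, hC0, hC⟩ := exists_uniform_bound fun j => (hφs j).2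
  obtain ⟨D, hD0, hD⟩ := exists_uniform_variation hφs (show 0 < ε / 4 by positivity)
  set η : ℝ := min (1 / 6) (ε / (36 * (|s| + C + 1))) with hη
  have hden : 0 < |s| + C + 1 := by positivity
  have hη0 : 0 < η := lt_min (by norm_num) (by positivity)
  have hη6 : η ≤ 1 / 6 := min_le_left _ _
  have hηM : 36 * (η * (|s| + C + 1)) ≤ ε := by
    have : η ≤ ε / (36 * (|s| + C + 1)) := min_le_right _ _
    rw [le_div_iff₀ (by positivity)] at this
    linarith
  have hηs : 36 * (η * |s|) ≤ ε := by nlinarith [mul_nonneg hη0.le hC0]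
  have hηC : 36 * (η * C) ≤ ε := by nlinarith [mul_nonneg hη0.le (abs_nonneg s)]
  obtain ⟨K, hK⟩ := exists_finset_words μ hinv hη0
  refine ⟨K, ?_⟩
  have htend : Tendsto (fun n : ℕ => (n : ℝ) * ε) atTop atTop :=
    tendsto_natCast_atTop_atTop.atTop_mul_const hε
  filter_upwards [hs, hJi, htend.eventually_ge_atTop 8, htend.eventually_ge_atTop (4 * D),
    eventually_ge_atTop 1] with m hm hJ hm8 hmD hm1
  obtain ⟨T, hends, hdist, hg⟩ := hK m
  set G : Set (Space A) := ⋃ t ∈ T, cyl t m with hGdef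
  set g : ℝ := μ.real G with hgdef
  have hGm : MeasurableSet G := Finset.measurableSet_biUnion _ fun t _ => measurableSet_cyl t m
  have hg1 : g ≤ 1 := measureReal_le_one
  have hghalf : 1 / 2 ≤ g := by linarith
  have hg0 : 0 < g := by linarith
  have hmpos : (0 : ℝ) < m := by exact_mod_cast hm1
  have hsplit : ∀ f : Space A → ℝ, Integrable f μ →
      ∑ t ∈ T, ∫ x in cyl t m, f x ∂μ = ∫ x, f x ∂μ - ∫ x in Gᶜ, f x ∂μ := fun f hf => by
    rw [← setIntegral_biUnion_cyl hdist hf, ← integral_add_compl hGm hf]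
    ring
  have hgsum : ∑ t ∈ T, μ.real (cyl t m) = g := by
    have := setIntegral_biUnion_cyl hdist (integrable_const (μ := μ) (1 : ℝ))
    simpa using this.symm
  refine ⟨T, fun t => μ.real (cyl t m) / g, hends, hdist, fun t => by positivity, ?_, ?_, ?_⟩
  · rw [← Finset.sum_div, hgsum, div_self hg0.ne']
  · have hterm : ∀ t ∈ T, μ.real (cyl t m) / g *
        Real.log (ν.real (cyl t m) / (μ.real (cyl t m) / g)) =
        (∫ x in cyl t m, logRatio μ ν m x ∂μ) / g + μ.real (cyl t m) / g * Real.log g := by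
      intro t _
      rw [setIntegral_cyl_of_dependsOnFirst μ (dependsOnFirst_logRatio μ ν m)]
      rcases (measureReal_nonneg (μ := μ) (s := cyl t m)).eq_or_lt with h | h
      · rw [← h]; simp
      · rw [logRatio, div_div_eq_mul_div, mul_div_right_comm,
          Real.log_mul (div_pos (hνpos m hm1 t) h).ne' hg0.ne']
        ring
    rw [Finset.sum_congr rfl hterm, Finset.sum_add_distrib, ← Finset.sum_div, ← Finset.sum_mul,
      ← Finset.sum_div, hgsum, div_self hg0.ne', one_mul, hsplit _ hJ]
    have hbad : ∫ x in Gᶜ, logRatio μ ν m x ∂μ ≤ 1 := by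
      obtain ⟨hr, hr1⟩ := integrable_cyl_ratio μ ν m
      calc ∫ x in Gᶜ, logRatio μ ν m x ∂μ
          ≤ ∫ x in Gᶜ, ν.real (cyl x m) / μ.real (cyl x m) ∂μ :=
            setIntegral_mono hJ.integrableOn hr.integrableOn
              fun x => (logRatio_bounds m x (hνpos m hm1 x)).2
        _ ≤ ∫ x, ν.real (cyl x m) / μ.real (cyl x m) ∂μ :=
            setIntegral_le_integral hr (Filter.Eventually.of_forall fun x => by positivity)
        _ ≤ 1 := hr1
    have hX : m * s - 1 ≤ ∫ x, logRatio μ ν m x ∂μ - ∫ x in Gᶜ, logRatio μ ν m x ∂μ := by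
      linarith
    have hXabs : |m * s - 1| ≤ m * |s| + 1 := by
      refine (abs_sub _ _).trans ?_
      rw [abs_mul, Nat.abs_cast, abs_one]
    have h1 := div_sub_le_of_half hghalf hg1 hXabs
    have h2 := div_le_div_of_nonneg_right hX hg0.le
    have hlog : -1 ≤ Real.log g := by
      have := Real.one_sub_inv_le_log_of_pos hg0
      have h3 : g⁻¹ ≤ 2 := by
        rw [inv_le_comm₀ hg0 (by norm_num)]
        linarith
      linarith
    have h4 : 2 * (1 - g) * (m * |s| + 1) ≤ 6 * η * (m * |s| + 1) :=
      mul_le_mul_of_nonneg_right (by linarith) (by positivity)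
    have h5 : m * (36 * (η * |s|)) ≤ m * ε := mul_le_mul_of_nonneg_left hηs hmpos.le
    nlinarith
  · intro j
    have hij : Integrable (φs j) μ := Integrable.of_bound (hφm j).aestronglyMeasurable C
      (Filter.Eventually.of_forall fun x => hC j x)
    have hiS := integrable_birkhoff hT hij m
    have hterm : ∀ t ∈ T, (∫ x in cyl t m, birkhoff (shift A) (φs j) m x ∂μ) / g
        - μ.real (cyl t m) / g * (m * (ε / 4) + D) ≤
        μ.real (cyl t m) / g * birkhoff (shift A) (φs j) m t := by
      intro t _
      have hle : ∫ x in cyl t m, birkhoff (shift A) (φs j) m x ∂μ ≤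
          μ.real (cyl t m) * (birkhoff (shift A) (φs j) m t + (m * (ε / 4) + D)) := by
        rw [← smul_eq_mul, ← setIntegral_const]
        refine setIntegral_mono_on hiS.integrableOn (integrable_const _) (measurableSet_cyl t m)
          fun x hx => ?_
        linarith [(abs_le.1 (hD j m t x hx)).2]
      have := div_le_div_of_nonneg_right hle hg0.le
      rw [mul_add, add_div] at this
      rw [div_mul_eq_mul_div, div_mul_eq_mul_div]
      linarith
    refine le_trans ?_ (Finset.sum_le_sum hterm)
    rw [Finset.sum_sub_distrib, ← Finset.sum_div, ← Finset.sum_mul,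
      ← Finset.sum_div, hgsum, div_self hg0.ne', one_mul, hsplit _ hiS, integral_birkhoff hT hij]
    have habs : ∀ B : Set (Space A), |∫ x in B, birkhoff (shift A) (φs j) m x ∂μ| ≤
        m * C * μ.real B := fun B => by
      have := norm_setIntegral_le_of_norm_le_const (μ := μ) (s := B) (C := m * C)
        (f := birkhoff (shift A) (φs j) m) (measure_lt_top μ _)
        (fun x _ => abs_birkhoff_le (hC j) m x)
      simpa using this
    have hcompl : μ.real Gᶜ = 1 - g := probReal_compl_eq_one_sub hGm
    have hbad := (abs_le.1 (habs Gᶜ)).2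
    rw [hcompl] at hbad
    have hYabs : |(m : ℝ) * ∫ x, φs j x ∂μ - ∫ x in Gᶜ, birkhoff (shift A) (φs j) m x ∂μ| ≤
        m * C := by
      have heq : (m : ℝ) * (∫ x, φs j x ∂μ) - ∫ x in Gᶜ, birkhoff (shift A) (φs j) m x ∂μ =
          ∫ x in G, birkhoff (shift A) (φs j) m x ∂μ := by
        rw [← integral_birkhoff hT hij, ← integral_add_compl hGm hiS]
        ring
      rw [heq]
      refine (habs G).trans ?_
      have : 0 ≤ m * C := by positivity
      nlinarith
    have h1 := div_sub_le_of_half hghalf hg1 hYabs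
    have hmC : 0 ≤ m * C := by positivity
    have h2 : 2 * (1 - g) * (m * C) ≤ 6 * η * (m * C) :=
      mul_le_mul_of_nonneg_right (by linarith) hmC
    have h3 : m * C * (1 - g) ≤ m * C * (3 * η) := mul_le_mul_of_nonneg_left (by linarith) hmC
    have h5 : m * (36 * (η * C)) ≤ m * ε := mul_le_mul_of_nonneg_left hηC hmpos.le
    nlinarith

end BlockSelection

end CMS

/-! ### A weak law of large numbers for finite product weights -/

namespace CMS

section LargeNumbers

variable {ι κ : Type*} [Fintype ι] [Fintype κ]

open Classical in
lemma exists_sum_pi_lower_tail_le {q g : ι → ℝ} (hq : ∀ a, 0 ≤ q a) (hq1 : ∑ a, q a = 1) {δ : ℝ}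
    (hδ : 0 < δ) (hg : δ ≤ ∑ a, q a * g a) :
    ∃ ρ : ℝ, 0 ≤ ρ ∧ ρ < 1 ∧ ∀ k : ℕ,
      ∑ t : Fin k → ι with ∑ i, g (t i) < 0, ∏ i, q (t i) ≤ ρ ^ k := by
  set B : ℝ := 1 + δ + ∑ a, |g a| with hB
  have hsum : 0 ≤ ∑ a, |g a| := Finset.sum_nonneg fun _ _ => abs_nonneg _
  have hB0 : 0 < B := by positivity
  have hgB : ∀ a, |g a| ≤ B := fun a => by
    have := Finset.single_le_sum (f := fun a => |g a|) (fun _ _ => abs_nonneg _)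
      (Finset.mem_univ a)
    linarith
  set c : ℝ := δ / (2 * B ^ 2) with hc
  have hc0 : 0 < c := by positivity
  have hcB : c * B ≤ 1 := by
    rw [hc, div_mul_eq_mul_div, div_le_one (by positivity)]
    nlinarith
  have hcB2 : c * B ^ 2 = δ / 2 := by
    rw [hc]
    field_simp
  have hpt : ∀ a, Real.exp (-(c * g a)) ≤ 1 - c * g a + c * (δ / 2) := fun a => by
    have habs : |-(c * g a)| ≤ 1 := by
      rw [abs_neg, abs_mul, abs_of_pos hc0]
      exact (mul_le_mul_of_nonneg_left (hgB a) hc0.le).trans hcB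
    have h1 := (abs_le.1 (Real.abs_exp_sub_one_sub_id_le habs)).2
    have h2 : (-(c * g a)) ^ 2 ≤ c * (δ / 2) := by
      have : g a ^ 2 ≤ B ^ 2 := sq_le_sq' (by linarith [(abs_le.1 (hgB a)).1])
        (abs_le.1 (hgB a)).2
      rw [← hcB2]
      nlinarith [mul_le_mul_of_nonneg_left this (sq_nonneg c)]
    linarith
  refine ⟨∑ a, q a * Real.exp (-(c * g a)),
    Finset.sum_nonneg fun a _ => mul_nonneg (hq a) (Real.exp_pos _).le, ?_, fun k => ?_⟩
  · calc ∑ a, q a * Real.exp (-(c * g a)) ≤ ∑ a, q a * (1 - c * g a + c * (δ / 2)) :=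
          Finset.sum_le_sum fun a _ => mul_le_mul_of_nonneg_left (hpt a) (hq a)
      _ = ∑ a, q a * (1 + c * (δ / 2)) - c * ∑ a, q a * g a := by
          rw [Finset.mul_sum, ← Finset.sum_sub_distrib]
          exact Finset.sum_congr rfl fun a _ => by ring
      _ < 1 := by
          rw [← Finset.sum_mul, hq1]
          nlinarith [mul_le_mul_of_nonneg_left hg hc0.le, mul_pos hc0 hδ]
  · rw [Finset.sum_pow', Fintype.piFinset_univ]
    refine (Finset.sum_le_sum fun t ht => ?_).trans
      (Finset.sum_le_sum_of_subset_of_nonneg (Finset.filter_subset _ _) fun t _ _ =>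
        Finset.prod_nonneg fun i _ => mul_nonneg (hq _) (Real.exp_pos _).le)
    rw [Finset.prod_mul_distrib, ← Real.exp_sum]
    refine le_mul_of_one_le_right (Finset.prod_nonneg fun i _ => hq _) (Real.one_le_exp ?_)
    rw [Finset.sum_neg_distrib, ← Finset.mul_sum]
    have := (Finset.mem_filter.1 ht).2
    nlinarith

open Classical in
lemma eventually_half_le_sum_pi {q : ι → ℝ} (hq : ∀ a, 0 ≤ q a) (hq1 : ∑ a, q a = 1)
    {f : κ → ι → ℝ} {b : κ → ℝ} (hb : ∀ j, b j ≤ ∑ a, q a * f j a) {δ : ℝ} (hδ : 0 < δ) :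
    ∀ᶠ k : ℕ in atTop,
      1 / 2 ≤ ∑ t : Fin k → ι with ∀ j, k * (b j - δ) ≤ ∑ i, f j (t i), ∏ i, q (t i) := by
  have htail : ∀ j, ∃ ρ : ℝ, 0 ≤ ρ ∧ ρ < 1 ∧ ∀ k : ℕ,
      ∑ t : Fin k → ι with ∑ i, (f j (t i) - (b j - δ)) < 0, ∏ i, q (t i) ≤ ρ ^ k := fun j => by
    refine exists_sum_pi_lower_tail_le (g := fun a => f j a - (b j - δ)) hq hq1 hδ ?_
    simp only [mul_sub, Finset.sum_sub_distrib, ← Finset.sum_mul, hq1]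
    linarith [hb j]
  choose ρ hρ0 hρ1 hρ using htail
  have hlim : Tendsto (fun k : ℕ => ∑ j, ρ j ^ k) atTop (𝓝 0) := by
    simpa using tendsto_finsetSum (Finset.univ : Finset κ)
      fun j _ => tendsto_pow_atTop_nhds_zero_of_lt_one (hρ0 j) (hρ1 j)
  filter_upwards [hlim.eventually_le_const (show (0 : ℝ) < 1 / 2 by norm_num)] with k hk
  have hw : ∀ t : Fin k → ι, 0 ≤ ∏ i, q (t i) := fun t => Finset.prod_nonneg fun i _ => hq _
  have htot : ∑ t : Fin k → ι, ∏ i, q (t i) = 1 := by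
    have := Finset.sum_pow' (Finset.univ : Finset ι) q k
    rw [Fintype.piFinset_univ, hq1, one_pow] at this
    exact this.symm
  have hbad : ∑ t : Fin k → ι with ¬ ∀ j, k * (b j - δ) ≤ ∑ i, f j (t i), ∏ i, q (t i) ≤
      ∑ j, ρ j ^ k := by
    refine le_trans ?_ (Finset.sum_le_sum fun j _ => hρ j k)
    simp only [Finset.sum_filter]
    rw [Finset.sum_comm]
    refine Finset.sum_le_sum fun t _ => ?_
    have hnn : ∀ j ∈ (Finset.univ : Finset κ),
        0 ≤ if ∑ i, (f j (t i) - (b j - δ)) < 0 then ∏ i, q (t i) else 0 := fun j _ => by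
      split_ifs
      exacts [hw t, le_rfl]
    by_cases h : ∀ j, k * (b j - δ) ≤ ∑ i, f j (t i)
    · rw [if_neg (not_not.2 h)]
      exact Finset.sum_nonneg hnn
    · rw [if_pos h]
      push Not at h
      obtain ⟨j, hj⟩ := h
      refine le_trans (le_of_eq ?_) (Finset.single_le_sum hnn (Finset.mem_univ j))
      rw [if_pos]
      rw [Finset.sum_sub_distrib, Finset.sum_const, Finset.card_univ, Fintype.card_fin,
        nsmul_eq_mul]
      linarith
  have := Finset.sum_filter_add_sum_filter_not (Finset.univ : Finset (Fin k → ι))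
    (fun t => ∀ j, k * (b j - δ) ≤ ∑ i, f j (t i)) fun t => ∏ i, q (t i)
  linarith

end LargeNumbers

end CMS

/-! ### Concatenation of blocks through a hub symbol -/

namespace CMS

section Gluing

variable {S : Type*} {A : S → S → Prop}

open Classical in
/-- The point following `x` up to time `n` and `y` afterwards, when `x` is at time `n` where `y`
starts (and `x` otherwise). -/
noncomputable def glue (x : Space A) (n : ℕ) (y : Space A) : Space A :=
  if h : x.1 n = y.1 0 then
    ⟨fun i => if i < n then x.1 i else y.1 (i - n), fun i => by
      rcases lt_trichotomy (i + 1) n with hi | hi | hi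
      · simpa [hi, (Nat.lt_succ_self i).trans hi] using x.2 i
      · subst hi
        simpa [← h] using x.2 i
      · have h1 : ¬ i < n := by omega
        have h2 : ¬ i + 1 < n := by omega
        simpa [h1, h2, Nat.sub_add_comm (not_lt.1 h1)] using y.2 (i - n)⟩
  else x

lemma glue_apply {x y : Space A} {n : ℕ} (h : x.1 n = y.1 0) (i : ℕ) :
    (glue x n y).1 i = if i < n then x.1 i else y.1 (i - n) :=
  congrArg (fun z : Space A => z.1 i) (dif_pos h)

lemma shift_iterate_glue {x y : Space A} {n : ℕ} (h : x.1 n = y.1 0) :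
    (shift A)^[n] (glue x n y) = y := by
  refine Subtype.ext (funext fun i => ?_)
  rw [shift_iterate_apply, glue_apply h]
  simp

lemma glue_mem_cyl {x y : Space A} {n : ℕ} (h : x.1 n = y.1 0) : glue x n y ∈ cyl x (n + 1) := by
  intro i hi
  rw [glue_apply h]
  rcases (Nat.lt_succ_iff.1 hi).lt_or_eq with h1 | rfl
  · simp [h1]
  · simp [h]

/-- A choice, for each pair of symbols, of a point joining the first to the second. -/
structure Bridges (A : S → S → Prop) where
  /-- The joining point. -/
  point : S → S → Space A
  /-- The time needed. -/
  len : S → S → ℕ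
  one_le_len : ∀ s s', 1 ≤ len s s'
  apply_zero : ∀ s s', (point s s').1 0 = s
  apply_len : ∀ s s', (point s s').1 (len s s') = s'

lemma TopTransitive.nonempty_bridges (h : TopTransitive A) : Nonempty (Bridges A) := by
  have : ∀ s s' : S, ∃ (x : Space A) (n : ℕ), 1 ≤ n ∧ x.1 0 = s ∧ x.1 n = s' := fun s s' => by
    obtain ⟨n, hn, x, hx, hx'⟩ := h s s'
    refine ⟨x, n, hn, hx ⟨0, by simp⟩, ?_⟩
    have := hx' ⟨0, by simp⟩
    simpa [shift_iterate_apply] using this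
  choose p n h1 h2 h3 using this
  exact ⟨⟨p, n, h1, h2, h3⟩⟩

namespace Bridges

variable (β : Bridges A) (a : S) (m : ℕ)

/-- The time from the hub `a` through the first `m` symbols of `t` back to the hub. -/
def blockLen (t : Space A) : ℕ := β.len a (t.1 0) + ((m - 1) + β.len (t.1 (m - 1)) a)

/-- The point going from the hub `a` through the first `m` symbols of `t` back to the hub, and
continuing as `y`. -/
noncomputable def block (t y : Space A) : Space A :=
  glue (β.point a (t.1 0)) (β.len a (t.1 0))
    (glue t (m - 1) (glue (β.point (t.1 (m - 1)) a) (β.len (t.1 (m - 1)) a) y))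

/-- The point going successively through blocks and continuing as `y`. -/
noncomputable def concat (y : Space A) : (k : ℕ) → (Fin k → Space A) → Space A
  | 0, _ => y
  | k + 1, t => β.block a m (t 0) (concat y k (Fin.tail t))

variable {β a m}

lemma le_blockLen (t : Space A) : β.len a (t.1 0) + m ≤ β.blockLen a m t := by
  have := β.one_le_len (t.1 (m - 1)) a
  unfold blockLen
  omega

lemma glue_out_apply_zero {s : S} {y : Space A} (hy : y.1 0 = a) :
    (glue (β.point s a) (β.len s a) y).1 0 = s := by
  rw [glue_mem_cyl (by rw [β.apply_len, hy]) 0 (by omega), β.apply_zero]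

lemma glue_word_apply_zero {t y : Space A} (hy : y.1 0 = a) :
    (glue t (m - 1) (glue (β.point (t.1 (m - 1)) a) (β.len (t.1 (m - 1)) a) y)).1 0 = t.1 0 :=
  glue_mem_cyl (glue_out_apply_zero hy).symm 0 (by omega)

lemma block_mem_cyl {t y : Space A} (hy : y.1 0 = a) :
    β.block a m t y ∈ cyl (β.point a (t.1 0)) (β.len a (t.1 0) + 1) :=
  glue_mem_cyl (by rw [β.apply_len, glue_word_apply_zero hy])

lemma block_apply_zero {t y : Space A} (hy : y.1 0 = a) : (β.block a m t y).1 0 = a := by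
  rw [block_mem_cyl hy 0 (by omega), β.apply_zero]

lemma shift_iterate_block {t y : Space A} (hy : y.1 0 = a) :
    (shift A)^[β.len a (t.1 0)] (β.block a m t y) =
      glue t (m - 1) (glue (β.point (t.1 (m - 1)) a) (β.len (t.1 (m - 1)) a) y) :=
  shift_iterate_glue (by rw [β.apply_len, glue_word_apply_zero hy])

lemma shift_iterate_block_mem_cyl {t y : Space A} (hy : y.1 0 = a) :
    (shift A)^[β.len a (t.1 0)] (β.block a m t y) ∈ cyl t m := by
  rw [shift_iterate_block hy]
  exact cyl_anti t (by omega) (glue_mem_cyl (glue_out_apply_zero hy).symm)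

lemma shift_iterate_blockLen {t y : Space A} (hy : y.1 0 = a) :
    (shift A)^[β.blockLen a m t] (β.block a m t y) = y := by
  rw [blockLen, add_comm, Function.iterate_add_apply, shift_iterate_block hy, add_comm (m - 1),
    Function.iterate_add_apply, shift_iterate_glue (glue_out_apply_zero hy).symm,
    shift_iterate_glue (by rw [β.apply_len, hy])]

lemma birkhoff_block (ψ : Space A → ℝ) {t y : Space A} (hy : y.1 0 = a) :
    birkhoff (shift A) ψ (β.blockLen a m t) (β.block a m t y) =
      birkhoff (shift A) ψ (β.len a (t.1 0)) (β.block a m t y) +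
      (birkhoff (shift A) ψ (m - 1)
        (glue t (m - 1) (glue (β.point (t.1 (m - 1)) a) (β.len (t.1 (m - 1)) a) y)) +
      birkhoff (shift A) ψ (β.len (t.1 (m - 1)) a)
        (glue (β.point (t.1 (m - 1)) a) (β.len (t.1 (m - 1)) a) y)) := by
  rw [blockLen, birkhoff_add, shift_iterate_block hy, birkhoff_add,
    shift_iterate_glue (glue_out_apply_zero hy).symm]

lemma concat_apply_zero {y : Space A} (hy : y.1 0 = a) :
    ∀ (k : ℕ) (t : Fin k → Space A), (β.concat a m y k t).1 0 = a
  | 0, _ => hy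
  | k + 1, t => block_apply_zero (concat_apply_zero hy k (Fin.tail t))

lemma sum_le_birkhoff_concat {y : Space A} (hy : y.1 0 = a) {ψ c : Space A → ℝ}
    {T : Set (Space A)} (hc : ∀ t ∈ T, ∀ z : Space A, z.1 0 = a →
      c t ≤ birkhoff (shift A) ψ (β.blockLen a m t) (β.block a m t z)) :
    ∀ (k : ℕ) (t : Fin k → Space A), (∀ i, t i ∈ T) → ∑ i, c (t i) ≤
      birkhoff (shift A) ψ (∑ i, β.blockLen a m (t i)) (β.concat a m y k t)
  | 0, _, _ => by simp [birkhoff]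
  | k + 1, t, ht => by
    have h0 := concat_apply_zero (β := β) (m := m) hy k (Fin.tail t)
    rw [Fin.sum_univ_succ, Fin.sum_univ_succ, birkhoff_add, concat, shift_iterate_blockLen h0]
    exact add_le_add (hc _ (ht 0) _ h0)
      (sum_le_birkhoff_concat hy hc k (Fin.tail t) fun i => ht i.succ)

lemma eq_of_concat_mem_cyl {y : Space A} (hy : y.1 0 = a) {T : Set (Space A)}
    (hT : ∀ t ∈ T, ∀ t' ∈ T, t' ∈ cyl t m → t' = t) :
    ∀ (k : ℕ) (t t' : Fin k → Space A), (∀ i, t i ∈ T) → (∀ i, t' i ∈ T) →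
      (∀ i, (t i).1 0 = (t' i).1 0 ∧ (t i).1 (m - 1) = (t' i).1 (m - 1)) →
      β.concat a m y k t' ∈ cyl (β.concat a m y k t) (∑ i, β.blockLen a m (t i)) → t' = t
  | 0, _, _, _, _, _, _ => Subsingleton.elim _ _
  | k + 1, t, t', ht, ht', htype, hmem => by
    have h0 := concat_apply_zero (β := β) (m := m) hy k (Fin.tail t)
    have h0' := concat_apply_zero (β := β) (m := m) hy k (Fin.tail t')
    have hlen : β.blockLen a m (t' 0) = β.blockLen a m (t 0) := by
      rw [blockLen, blockLen, (htype 0).1, (htype 0).2]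
    rw [Fin.sum_univ_succ] at hmem
    have htail : Fin.tail t' = Fin.tail t := by
      refine eq_of_concat_mem_cyl hy hT k _ _ (fun i => ht i.succ) (fun i => ht' i.succ)
        (fun i => htype i.succ) ?_
      have := shift_iterate_mem_cyl hmem le_rfl
      rw [concat, concat, shift_iterate_blockLen h0, ← hlen, shift_iterate_blockLen h0'] at this
      exact this
    have hhead : t' 0 = t 0 := by
      refine hT _ (ht 0) _ (ht' 0) ?_
      have h1 := shift_iterate_mem_cyl hmem
        ((le_blockLen (β := β) (a := a) (m := m) (t 0)).trans (Nat.le_add_right _ _))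
      rw [concat, concat] at h1
      have h2 : (shift A)^[β.len a ((t 0).1 0)] (β.block a m (t' 0)
          (β.concat a m y k (Fin.tail t'))) ∈ cyl (t' 0) m := by
        rw [(htype 0).1]
        exact shift_iterate_block_mem_cyl h0'
      rw [← cyl_eq_of_mem (shift_iterate_block_mem_cyl h0), ← cyl_eq_of_mem h1, cyl_eq_of_mem h2]
      exact mem_cyl_self _ _
    rw [← Fin.cons_self_tail t, ← Fin.cons_self_tail t', htail, hhead]

end Bridges

end Gluing

end CMS

/-! ### Estimates along concatenated blocks -/

namespace CMS

section BlockEstimates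

variable {S : Type*} {A : S → S → Prop}

lemma birkhoff_sub_const {X : Type*} (T : X → X) (φ : X → ℝ) (c : ℝ) (n : ℕ) (x : X) :
    birkhoff T (fun x => φ x - c) n x = birkhoff T φ n x - c * n := by
  simp [birkhoff, Finset.sum_sub_distrib, mul_comm]

namespace Bridges

variable {β : Bridges A} {a : S} {m : ℕ}

lemma exists_blockLen_le (β : Bridges A) (a : S) (K : Finset S) :
    ∃ D : ℕ, ∀ (m : ℕ) (t : Space A), t.1 0 ∈ K → t.1 (m - 1) ∈ K → β.blockLen a m t ≤ m + D := by
  refine ⟨∑ s ∈ K, β.len a s + ∑ s ∈ K, β.len s a, fun m t h0 h1 => ?_⟩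
  have h2 := Finset.single_le_sum (f := fun s => β.len a s) (fun _ _ => Nat.zero_le _) h0
  have h3 := Finset.single_le_sum (f := fun s => β.len s a) (fun _ _ => Nat.zero_le _) h1
  unfold blockLen
  omega

lemma le_birkhoff_block_of_variation {ψ : Space A → ℝ} {C D ε : ℝ} (hC : ∀ x, |ψ x| ≤ C)
    (hD : ∀ n x y, y ∈ cyl x n → |birkhoff (shift A) ψ n y - birkhoff (shift A) ψ n x| ≤ n * ε + D)
    {t y : Space A} (hy : y.1 0 = a) :
    birkhoff (shift A) ψ m t - (m * ε + D) - C * (β.blockLen a m t - m : ℕ) ≤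
      birkhoff (shift A) ψ (β.blockLen a m t) (β.block a m t y) := by
  obtain ⟨r, hr⟩ := Nat.exists_eq_add_of_le (le_blockLen (β := β) (a := a) (m := m) t)
  set u := β.len a (t.1 0) with hu
  have h1 := (abs_le.1 (abs_birkhoff_le (T := shift A) hC u (β.block a m t y))).1
  have h2 := (abs_le.1 (hD m t _ (shift_iterate_block_mem_cyl (β := β) hy))).1
  have h3 := (abs_le.1 (abs_birkhoff_le (T := shift A) hC r
    ((shift A)^[u + m] (β.block a m t y)))).1
  have h4 : ((u + m + r - m : ℕ) : ℝ) = u + r := by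
    rw [show u + m + r - m = u + r by omega]
    push_cast
    ring
  rw [hr, birkhoff_add, birkhoff_add, h4]
  linarith

variable [TopologicalSpace S]

lemma exists_le_birkhoff_block {φ : Space A → ℝ} {ν : Measure (Space A)} [IsFiniteMeasure ν]
    {c₀ P : ℝ} (hc : 1 ≤ c₀) (hG : IsGibbsWith A φ ν c₀ P) (β : Bridges A) (a : S)
    (K : Finset S) :
    ∃ B : ℝ, 0 ≤ B ∧ ∀ m, 2 ≤ m → ∀ t y : Space A, t.1 0 ∈ K → t.1 (m - 1) ∈ K → y.1 0 = a →
      Real.log (ν.real (cyl t m)) - B ≤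
        birkhoff (shift A) (fun x => φ x - P) (β.blockLen a m t) (β.block a m t y) := by
  set f : S → ℝ := fun s => |Real.log (ν.real (cyl (β.point a s) (β.len a s)))| with hf
  set g : S → ℝ := fun s => |Real.log (ν.real (cyl (β.point s a) (β.len s a)))| with hg
  refine ⟨3 * Real.log c₀ + ∑ s ∈ K, f s + ∑ s ∈ K, g s, ?_, fun m hm t y h0 h1 hy => ?_⟩
  · have := Real.log_nonneg hc
    positivity
  have hθ : ∀ {n : ℕ}, 1 ≤ n → ∀ x z : Space A, x ∈ cyl z n →
      Real.log (ν.real (cyl z n)) - Real.log c₀ ≤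
        birkhoff (shift A) (fun x => φ x - P) n x := fun hn x z hx => by
    rw [birkhoff_sub_const, ← cyl_eq_of_mem hx]
    linarith [hG.log_le hc hn x]
  have h2 := Finset.single_le_sum (f := f) (fun _ _ => abs_nonneg _) h0
  have h3 := Finset.single_le_sum (f := g) (fun _ _ => abs_nonneg _) h1
  have h4 := hθ (β.one_le_len _ _) _ _
    (cyl_anti _ (Nat.le_succ _) (block_mem_cyl (β := β) (m := m) (t := t) hy))
  have h5 := hθ (β.one_le_len _ _) _ _ (cyl_anti _ (Nat.le_succ _)
    (glue_mem_cyl (x := β.point (t.1 (m - 1)) a) (y := y) (by rw [β.apply_len, hy])))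
  have h6 := hθ (show 1 ≤ m - 1 by omega) _ _ (cyl_anti _ (Nat.le_succ _)
    (glue_mem_cyl (glue_out_apply_zero (β := β) (s := t.1 (m - 1)) hy).symm))
  have h7 : Real.log (ν.real (cyl t m)) ≤ Real.log (ν.real (cyl t (m - 1))) :=
    Real.log_le_log (hG.real_cyl_pos hc (by omega) t)
      (measureReal_mono (cyl_anti t (Nat.sub_le _ _)))
  rw [birkhoff_block _ hy]
  have h8 := neg_abs_le (Real.log (ν.real (cyl (β.point a (t.1 0)) (β.len a (t.1 0)))))
  have h9 := neg_abs_le (Real.log (ν.real (cyl (β.point (t.1 (m - 1)) a)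
    (β.len (t.1 (m - 1)) a))))
  simp only [hf, hg] at h2 h3 ⊢
  linarith

end Bridges

open Classical in
lemma sum_measureReal_le_card_mul {X ι τ : Type*} [MeasurableSpace X] {ν : Measure X}
    [IsFiniteMeasure ν] [Fintype τ] {G : Finset ι} {s : ι → Set X} {E : Set X} (f : ι → τ)
    (hs : ∀ i ∈ G, MeasurableSet (s i)) (hE : ∀ i ∈ G, s i ⊆ E)
    (hd : ∀ i ∈ G, ∀ j ∈ G, f i = f j → i ≠ j → Disjoint (s i) (s j)) :
    ∑ i ∈ G, ν.real (s i) ≤ Fintype.card τ * ν.real E := by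
  rw [← Finset.sum_fiberwise G f, ← nsmul_eq_mul]
  refine Finset.sum_le_card_nsmul _ _ _ fun c _ => ?_
  rw [← measureReal_biUnion_finset]
  · exact measureReal_mono (Set.iUnion₂_subset fun i hi => hE i (Finset.mem_filter.1 hi).1)
  · intro i hi j hj hij
    have hi := Finset.mem_filter.1 hi
    have hj := Finset.mem_filter.1 hj
    exact hd i hi.1 j hj.1 (hi.2.trans hj.2.symm) hij
  · exact fun i hi => hs i (Finset.mem_filter.1 hi).1

end BlockEstimates

end CMS

/-! ### The lower bound for cylinders of positive Birkhoff sums -/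

namespace CMS

section Core

variable {S : Type*} {A : S → S → Prop} [TopologicalSpace S]
  {φ : Space A → ℝ} {ν : Measure (Space A)} {c₀ P : ℝ}

lemma IsGibbsWith.exp_le_real_cyl (hG : IsGibbsWith A φ ν c₀ P) {n : ℕ} (hn : 1 ≤ n)
    (x : Space A) :
    c₀⁻¹ * Real.exp (birkhoff (shift A) (fun x => φ x - P) n x) ≤ ν.real (cyl x n) := by
  have := (hG n hn x).1
  rw [cylinder_word] at this
  rw [birkhoff_sub_const, sub_eq_neg_add]
  exact this

lemma mul_exp_log_div_le {q c : ℝ} (hq : 0 ≤ q) (hc : 0 < c) :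
    q * Real.exp (Real.log (c / q)) ≤ c := by
  rcases hq.eq_or_lt with rfl | hq
  · simpa using hc.le
  · rw [Real.exp_log (div_pos hc hq), mul_div_cancel₀ _ hq.ne']

variable [DiscreteTopology S]

open Classical in
lemma IsBlockFamily.exists_exp_le_card_mul {ι : Type*} [Fintype ι] [IsFiniteMeasure ν]
    (hc : 1 ≤ c₀) (hG : IsGibbsWith A φ ν c₀ P) {φs : ι → Space A → ℝ} {K : Finset S} {m : ℕ}
    (hm : 1 ≤ m) {s : ℝ} {I : ι → ℝ} {T : Finset (Space A)} {q : Space A → ℝ}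
    (h : IsBlockFamily ν φs K m s I T q) (β : Bridges A) (y : Space A) {B : ℝ}
    (hB : ∀ t z : Space A, t.1 0 ∈ K → t.1 (m - 1) ∈ K → z.1 0 = y.1 0 →
      Real.log (ν.real (cyl t m)) - B ≤ birkhoff (shift A) (fun x => φ x - P)
        (β.blockLen (y.1 0) m t) (β.block (y.1 0) m t z)) {ε : ℝ} (hε : 0 < ε) :
    ∀ᶠ k : ℕ in atTop, ∀ E : Set (Space A),
      (∀ t : Fin k → Space A, (∀ i, t i ∈ T) →
        (∀ j, k * (m * I j - m * ε) ≤ ∑ i, birkhoff (shift A) (φs j) m (t i)) →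
        cyl (β.concat (y.1 0) m y k t) (∑ i, β.blockLen (y.1 0) m (t i)) ⊆ E) →
      (2 * c₀)⁻¹ * Real.exp (k * (m * s - m * ε - B)) ≤ ((K.card : ℝ) * K.card) ^ k * ν.real E := by
  have hm0 : (0 : ℝ) < m := by exact_mod_cast hm
  have hc0 : 0 < c₀ := by linarith
  have hlln := eventually_half_le_sum_pi (ι := T) (κ := Option ι) (q := fun t => q t)
    (f := fun j t => j.elim (Real.log (ν.real (cyl t.1 m) / q t.1))
      fun j => birkhoff (shift A) (φs j) m t.1)
    (b := fun j => j.elim (m * s) fun j => m * I j) (fun t => h.nonneg t)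
    ((Finset.sum_coe_sort T q).trans h.sum_eq_one) (by
      rintro (_ | j)
      · exact h.le_sum_log.trans_eq (Finset.sum_coe_sort T
          fun t => q t * Real.log (ν.real (cyl t m) / q t)).symm
      · exact (h.le_sum_birkhoff j).trans_eq (Finset.sum_coe_sort T
          fun t => q t * birkhoff (shift A) (φs j) m t).symm) (mul_pos hm0 hε)
  filter_upwards [hlln, eventually_ge_atTop 1] with k hk hk1 E hE
  set G := Finset.univ.filter fun t : Fin k → T => ∀ j : Option ι,
    k * (j.elim (m * s) (fun j => m * I j) - m * ε) ≤ ∑ i, j.elim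
      (Real.log (ν.real (cyl (t i).1 m) / q (t i).1)) fun j => birkhoff (shift A) (φs j) m (t i).1
    with hGdef
  set pt : (Fin k → T) → Space A := fun t => β.concat (y.1 0) m y k fun i => (t i).1 with hpt
  set len : (Fin k → T) → ℕ := fun t => ∑ i, β.blockLen (y.1 0) m (t i).1 with hlen
  have hlen1 : ∀ t, 1 ≤ len t := fun t => by
    have := Finset.card_nsmul_le_sum Finset.univ (fun i => β.blockLen (y.1 0) m (t i).1) 1
      fun i _ => hm.trans ((Nat.le_add_left _ _).trans (Bridges.le_blockLen (t i).1))
    simp only [Finset.card_univ, Fintype.card_fin, smul_eq_mul, mul_one] at this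
    exact hk1.trans this
  have hcount : ∑ t ∈ G, ν.real (cyl (pt t) (len t)) ≤
      ((K.card : ℝ) * K.card) ^ k * ν.real E := by
    have := sum_measureReal_le_card_mul (ν := ν) (G := G) (s := fun t => cyl (pt t) (len t))
      (E := E) (τ := Fin k → K × K)
      (fun t i => (⟨(t i).1.1 0, (h.ends _ (t i).2).1⟩, ⟨(t i).1.1 (m - 1), (h.ends _ (t i).2).2⟩))
      (fun t _ => measurableSet_cyl _ _)
      (fun t ht => hE _ (fun i => (t i).2) fun j => (Finset.mem_filter.1 ht).2 (some j)) ?_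
    · simpa using this
    intro t _ t' _ htt' hne
    have htype : ∀ i, (t i).1.1 0 = (t' i).1.1 0 ∧ (t i).1.1 (m - 1) = (t' i).1.1 (m - 1) :=
      fun i => by
        have := congrFun htt' i
        simp only [Prod.mk.injEq, Subtype.mk.injEq] at this
        exact this
    have hl : len t' = len t := Finset.sum_congr rfl fun i _ => by
      rw [Bridges.blockLen, Bridges.blockLen, (htype i).1, (htype i).2]
    rw [hl]
    refine cyl_disjoint fun hmem => hne ?_
    have := Bridges.eq_of_concat_mem_cyl rfl h.eq_of_mem k (fun i => (t i).1)
      (fun i => (t' i).1) (fun i => (t i).2) (fun i => (t' i).2) htype hmem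
    exact funext fun i => Subtype.ext (congrFun this i).symm
  refine le_trans ?_ hcount
  have hterm : ∀ t ∈ G, (∏ i, q (t i)) * (c₀⁻¹ * Real.exp (k * (m * s - m * ε - B))) ≤
      ν.real (cyl (pt t) (len t)) := fun t ht => by
    refine le_trans ?_ (hG.exp_le_real_cyl (hlen1 t) (pt t))
    rw [mul_left_comm]
    refine mul_le_mul_of_nonneg_left ?_ (by positivity)
    have h1 := Bridges.sum_le_birkhoff_concat (β := β) (y := y) (m := m) rfl
      (ψ := fun x => φ x - P) (c := fun t => Real.log (ν.real (cyl t m)) - B) (T := (T : Set _))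
      (fun t ht z hz => hB t z (h.ends t ht).1 (h.ends t ht).2 hz) k (fun i => (t i).1)
      fun i => (t i).2
    refine le_trans ?_ (Real.exp_le_exp.2 h1)
    have h2 := (Finset.mem_filter.1 ht).2 none
    simp only [Option.elim_none] at h2
    have hp : ∀ i, 0 < ν.real (cyl (t i).1 m) := fun i => hG.real_cyl_pos hc hm _
    calc (∏ i, q (t i)) * Real.exp (k * (m * s - m * ε - B))
        ≤ (∏ i, q (t i)) * Real.exp (∑ i, (Real.log (ν.real (cyl (t i).1 m) / q (t i).1) - B)) := by
          refine mul_le_mul_of_nonneg_left (Real.exp_le_exp.2 ?_)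
            (Finset.prod_nonneg fun i _ => h.nonneg _)
          rw [Finset.sum_sub_distrib, Finset.sum_const, Finset.card_univ, Fintype.card_fin,
            nsmul_eq_mul]
          linarith
      _ = ∏ i, (q (t i) * Real.exp (Real.log (ν.real (cyl (t i).1 m) / q (t i).1)) *
            Real.exp (-B)) := by
          rw [Real.exp_sum, ← Finset.prod_mul_distrib]
          exact Finset.prod_congr rfl fun i _ => by rw [sub_eq_add_neg, Real.exp_add, mul_assoc]
      _ ≤ ∏ i, (ν.real (cyl (t i).1 m) * Real.exp (-B)) :=
          Finset.prod_le_prod (fun i _ => mul_nonneg (mul_nonneg (h.nonneg _)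
            (Real.exp_pos _).le) (Real.exp_pos _).le) fun i _ =>
            mul_le_mul_of_nonneg_right (mul_exp_log_div_le (h.nonneg _) (hp i)) (Real.exp_pos _).le
      _ = Real.exp (∑ i, (Real.log (ν.real (cyl (t i).1 m)) - B)) := by
          rw [Real.exp_sum]
          exact Finset.prod_congr rfl fun i _ => by
            rw [sub_eq_add_neg, Real.exp_add, Real.exp_log (hp i)]
  refine le_trans ?_ (Finset.sum_le_sum hterm)
  rw [← Finset.sum_mul, mul_inv, mul_assoc]
  exact mul_le_mul_of_nonneg_right (by simpa using hk) (by positivity)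

end Core

end CMS

namespace CMS

section CoreBound

variable {S : Type*} {A : S → S → Prop} [TopologicalSpace S] [DiscreteTopology S]

lemma UnifCont.continuous {ψ : Space A → ℝ} (h : UnifCont A ψ) : Continuous ψ := by
  refine Metric.continuous_iff'.2 fun x ε hε => ?_
  obtain ⟨N, hN⟩ := h (ε / 2) (half_pos hε)
  filter_upwards [(isOpen_cyl x N).mem_nhds (mem_cyl_self x N)] with y hy
  rw [Real.dist_eq]
  linarith [hN y x hy]

lemma exists_uniform_gap {ι : Type*} [Fintype ι] {α I : ι → ℝ} (h : ∀ j, α j < I j) {g : ℝ}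
    (hg : 0 < g) : ∃ ε : ℝ, 0 < ε ∧ 4 * ε ≤ g ∧ ∀ j, α j + 8 * ε ≤ I j := by
  have hlim : ∀ c d : ℝ, Tendsto (fun ε : ℝ => c + d * ε) (𝓝[>] 0) (𝓝 c) := fun c d => by
    have : Tendsto (fun ε : ℝ => c + d * ε) (𝓝 0) (𝓝 (c + d * 0)) := by
      exact (continuous_const.add (continuous_const.mul continuous_id)).tendsto 0
    rw [mul_zero, add_zero] at this
    exact this.mono_left nhdsWithin_le_nhds
  have h1 : ∀ᶠ ε : ℝ in 𝓝[>] 0, 0 + 4 * ε ≤ g := (hlim 0 4).eventually_le_const hg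
  have h2 : ∀ᶠ ε : ℝ in 𝓝[>] 0, ∀ j, α j + 8 * ε ≤ I j :=
    Filter.eventually_all.2 fun j => (hlim (α j) 8).eventually_le_const (h j)
  obtain ⟨ε, ⟨h3, h4⟩, h5⟩ := ((h1.and h2).and self_mem_nhdsWithin).exists
  exact ⟨ε, h5, by linarith, h4⟩

lemma tendsto_natCast_div_add_one {m : ℕ} (hm : 1 ≤ m) :
    Tendsto (fun n : ℕ => n / m + 1) atTop atTop :=
  tendsto_atTop_mono (fun n => Nat.le_succ _) (Nat.tendsto_div_const_atTop (by omega))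

variable [Countable S] {φ : Space A → ℝ} {ν : Measure (Space A)} {c₀ P : ℝ}

lemma exists_eventually_exp_le_real [IsProbabilityMeasure ν] (hc : 1 ≤ c₀)
    (hG : IsGibbsWith A φ ν c₀ P) (hφ : Measurable φ) (htrans : TopTransitive A)
    {ι : Type*} [Fintype ι] {φs : ι → Space A → ℝ} (hφs : ∀ j, UnifCont A (φs j) ∧ Bdd A (φs j))
    {α : ι → ℝ} {μ : ProbabilityMeasure (Space A)}
    (hα : ∀ j, α j < ∫ x, φs j x ∂(μ : Measure (Space A))) {r : ℝ}
    (hr : (r : EReal) < freeEnergy (shift A) φ P μ) :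
    ∃ δ : ℝ, 0 < δ ∧ ∀ᶠ n : ℕ in atTop, Real.exp (n * r) ≤
      ν.real {x | ∀ j, n * (α j + δ) ≤ birkhoff (shift A) (φs j) n x} := by
  obtain ⟨s, hrs, hs⟩ := EReal.lt_iff_exists_real_btwn.1 hr
  have hrs : r < s := EReal.coe_lt_coe_iff.1 hrs
  obtain ⟨hinv, hφμ, hev⟩ := eventually_le_integral_logRatio hc hG hφ hs
  set I : ι → ℝ := fun j => ∫ x, φs j x ∂(μ : Measure (Space A)) with hI
  obtain ⟨ε, hε, hεg, hεα⟩ := exists_uniform_gap hα (sub_pos.2 hrs)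
  obtain ⟨C, hC0, hC⟩ := exists_uniform_bound fun j => (hφs j).2
  obtain ⟨D, hD0, hD⟩ := exists_uniform_variation hφs hε
  have hJi : ∀ᶠ n : ℕ in atTop, Integrable (logRatio (μ : Measure (Space A)) ν n) μ := by
    filter_upwards [eventually_ge_atTop 1] with n hn
    exact (integrable_logRatio hc hG hinv hφμ hn).2.1
  obtain ⟨K, hK⟩ := exists_isBlockFamily hφs (fun j => (hφs j).1.continuous.measurable)
    (μ : Measure (Space A)) ν hinv hJi (fun n hn x => hG.real_cyl_pos hc hn x) hev hε
  obtain ⟨β⟩ := htrans.nonempty_bridges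
  obtain ⟨y⟩ : Nonempty (Space A) := nonempty_of_isProbabilityMeasure ν
  obtain ⟨B, hB0, hB⟩ := Bridges.exists_le_birkhoff_block hc hG β (y.1 0) K
  obtain ⟨D', hD'⟩ := Bridges.exists_blockLen_le β (y.1 0) K
  set κ : ℝ := (K.card : ℝ) * K.card + 1 with hκ
  have hκ1 : 1 ≤ κ := by
    have : (0 : ℝ) ≤ (K.card : ℝ) * K.card := by positivity
    linarith
  have htend : Tendsto (fun n : ℕ => (n : ℝ) * ε) atTop atTop :=
    tendsto_natCast_atTop_atTop.atTop_mul_const hε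
  obtain ⟨m, ⟨⟨⟨T, q, hTq⟩, hm2⟩, hmB⟩, hmD⟩ := (((hK.and (eventually_ge_atTop 2)).and
    (htend.eventually_ge_atTop (B + Real.log κ))).and
    (htend.eventually_ge_atTop (D + C * D'))).exists
  have hm1 : 1 ≤ m := by omega
  have hcount := hTq.exists_exp_le_card_mul hc hG hm1 β y
    (fun t z h0 h1 hz => hB m hm2 t z h0 h1 hz) hε
  refine ⟨ε, hε, ?_⟩
  filter_upwards [(tendsto_natCast_div_add_one hm1).eventually hcount,
    htend.eventually_ge_atTop (m * |s - 4 * ε| + Real.log (2 * c₀)),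
    Filter.eventually_all.2 fun j => htend.eventually_ge_atTop
      (m * |I j - 5 * ε| + C * m + D)] with n hn hns hnj
  set k := n / m + 1 with hk
  have hkm : n ≤ k * m := by
    have := Nat.lt_div_mul_add (a := n) (show 0 < m by omega)
    rw [hk, add_mul]
    omega
  have hkm' : k * m ≤ n + m := by
    have := Nat.div_mul_le_self n m
    rw [hk, add_mul]
    omega
  have hkmR : (n : ℝ) ≤ k * m := by exact_mod_cast hkm
  have hkmR' : (k : ℝ) * m ≤ n + m := by exact_mod_cast hkm'
  have hkey : ∀ c : ℝ, n * c - m * |c| ≤ k * m * c := fun c => by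
    rcases le_total 0 c with h | h
    · rw [abs_of_nonneg h]
      nlinarith [mul_nonneg (Nat.cast_nonneg (α := ℝ) m) h]
    · rw [abs_of_nonpos h]
      nlinarith
  have hn := hn {x | ∀ j, n * (α j + ε) ≤ birkhoff (shift A) (φs j) n x} ?_
  · have h1 : (2 * c₀)⁻¹ * Real.exp (k * (m * (s - ε) - m * ε - B)) ≤
        κ ^ k * ν.real {x | ∀ j, n * (α j + ε) ≤ birkhoff (shift A) (φs j) n x} :=
      hn.trans (mul_le_mul_of_nonneg_right
        (pow_le_pow_left₀ (by positivity) (by rw [hκ]; linarith) k) measureReal_nonneg)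
    have hκk : κ ^ k = Real.exp (k * Real.log κ) := by
      rw [Real.exp_nat_mul, Real.exp_log (by linarith)]
    have hc2 : (2 * c₀)⁻¹ = Real.exp (-Real.log (2 * c₀)) := by
      rw [Real.exp_neg, Real.exp_log (by linarith)]
    rw [hκk, hc2, ← Real.exp_add, mul_comm (Real.exp _) (ν.real _), ← div_le_iff₀ (Real.exp_pos _),
      ← Real.exp_sub] at h1
    refine le_trans (Real.exp_le_exp.2 ?_) h1
    have h2 := hkey (s - 4 * ε)
    have h3 : (k : ℝ) * (B + Real.log κ) ≤ k * (m * ε) :=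
      mul_le_mul_of_nonneg_left hmB (Nat.cast_nonneg _)
    have h4 : (n : ℝ) * (r + 4 * ε) ≤ n * s :=
      mul_le_mul_of_nonneg_left (by linarith) (Nat.cast_nonneg _)
    have h5 : (0 : ℝ) ≤ k * m * ε := by positivity
    nlinarith
  · intro t ht hgood x hx j
    set L := ∑ i, β.blockLen (y.1 0) m (t i) with hL
    set z := β.concat (y.1 0) m y k t with hz
    have hmL : k * m ≤ L := by
      have := Finset.card_nsmul_le_sum Finset.univ (fun i => β.blockLen (y.1 0) m (t i)) m
        fun i _ => (Nat.le_add_left _ _).trans (Bridges.le_blockLen (t i))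
      simpa using this
    have hLm : L ≤ k * (m + D') := by
      have := Finset.sum_le_card_nsmul Finset.univ (fun i => β.blockLen (y.1 0) m (t i)) (m + D')
        fun i _ => hD' m (t i) (hTq.ends _ (ht i)).1 (hTq.ends _ (ht i)).2
      simpa using this
    have h1 : ∑ i, birkhoff (shift A) (φs j) m (t i) - k * (m * ε + D + C * D') ≤
        birkhoff (shift A) (φs j) L z := by
      have := Bridges.sum_le_birkhoff_concat (β := β) (y := y) (m := m) rfl (ψ := φs j)
        (c := fun t => birkhoff (shift A) (φs j) m t - (m * ε + D + C * D')) (T := (T : Set _))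
        (fun t ht z hz => ?_) k t ht
      · rwa [Finset.sum_sub_distrib, Finset.sum_const, Finset.card_univ, Fintype.card_fin,
          nsmul_eq_mul] at this
      · refine le_trans ?_ (Bridges.le_birkhoff_block_of_variation (hC j) (hD j) hz)
        have h2 : ((β.blockLen (y.1 0) m t - m : ℕ) : ℝ) ≤ D' := by
          have := hD' m t (hTq.ends _ ht).1 (hTq.ends _ ht).2
          exact_mod_cast Nat.sub_le_iff_le_add'.2 this
        have := mul_le_mul_of_nonneg_left h2 hC0
        linarith
    obtain ⟨u, hu⟩ := Nat.exists_eq_add_of_le (hkm.trans hmL)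
    have huR : (u : ℝ) ≤ k * D' + m := by
      have : u ≤ k * D' + m := by
        rw [mul_add] at hLm
        omega
      exact_mod_cast this
    have h2 := (abs_le.1 (abs_birkhoff_le (T := shift A) (hC j) u ((shift A)^[n] z))).2
    rw [hu, birkhoff_add] at h1
    have h3 := (abs_le.1 (hD j n z x (cyl_anti z (hkm.trans hmL) hx))).1
    have h4 := hgood j
    have h5 := mul_le_mul_of_nonneg_right huR hC0
    have h6 : (k : ℝ) * (D + C * D') ≤ k * (m * ε) :=
      mul_le_mul_of_nonneg_left hmD (Nat.cast_nonneg _)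
    have h7 : (0 : ℝ) ≤ k * D := by positivity
    have h8 := hkey (I j - 5 * ε)
    have h9 := hnj j
    have h10 : (n : ℝ) * (α j + 8 * ε) ≤ n * I j :=
      mul_le_mul_of_nonneg_left (hεα j) (Nat.cast_nonneg _)
    simp only [hI] at *
    linarith

end CoreBound

end CMS

/-! ### Empirical measures -/

namespace CMS

section Empirical

lemma iSup_le_liminf_inv_mul_log {M : Type*} {V : Set M} {F : M → EReal} {ρ : ℕ → ℝ≥0∞}
    (h : ∀ μ ∈ V, ∀ r : ℝ, (r : EReal) < F μ →
      ∀ᶠ n : ℕ in atTop, ENNReal.ofReal (Real.exp (n * r)) ≤ ρ n) :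
    ⨆ μ ∈ V, F μ ≤
      atTop.liminf fun n : ℕ => (((n : ℝ)⁻¹ : ℝ) : EReal) * ENNReal.log (ρ n) := by
  refine iSup₂_le fun μ hμ => le_of_forall_lt_imp_le_of_dense fun c hc => ?_
  obtain ⟨r, hcr, hr⟩ := EReal.lt_iff_exists_real_btwn.1 hc
  refine hcr.le.trans (le_liminf_of_le (by isBoundedDefault) ?_)
  filter_upwards [h μ hμ r hr, eventually_ge_atTop 1] with n hn hn1
  have hn0 : (0 : ℝ) < n := by exact_mod_cast hn1
  have h1 := ENNReal.log_le_log hn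
  rw [ENNReal.log_ofReal_of_pos (Real.exp_pos _), Real.log_exp] at h1
  calc (r : EReal) = (((n : ℝ)⁻¹ : ℝ) : EReal) * ((n * r : ℝ) : EReal) := by
        rw [← EReal.coe_mul, inv_mul_cancel_left₀ hn0.ne']
    _ ≤ _ := mul_le_mul_of_nonneg_left h1 (by exact_mod_cast inv_nonneg.2 hn0.le)

lemma integral_empirical {X : Type*} [MeasurableSpace X] (T : X → X) {ψ : X → ℝ}
    (hψ : Measurable ψ) (x : X) {n : ℕ} (hn : 1 ≤ n) :
    ∫ z, ψ z ∂(empirical T x n : Measure X) = (n : ℝ)⁻¹ * birkhoff T ψ n x := by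
  have : (empirical T x n : Measure X) =
      ((n : ℕ) : ℝ≥0∞)⁻¹ • ∑ i ∈ Finset.range n, Measure.dirac (T^[i] x) := by
    conv_rhs => rw [← max_eq_left hn]
    rfl
  rw [this, integral_smul_measure, integral_finsetSum_measure]
  · simp only [integral_dirac' _ _ hψ.stronglyMeasurable, birkhoff, smul_eq_mul]
    simp
  · exact fun i _ => integrable_dirac' hψ.stronglyMeasurable (by simp)

instance {X : Type*} [MeasurableSpace X] [TopologicalSpace X] [OpensMeasurableSpace X] :
    BorelSpace (ProbabilityMeasure X) := ⟨rfl⟩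

lemma continuous_birkhoff {X : Type*} [TopologicalSpace X] {T : X → X} (hT : Continuous T)
    {ψ : X → ℝ} (hψ : Continuous ψ) (n : ℕ) : Continuous (birkhoff T ψ n) :=
  continuous_finsetSum _ fun i _ => hψ.comp (hT.iterate i)

lemma continuous_empirical {X : Type*} [TopologicalSpace X] [MeasurableSpace X] [BorelSpace X]
    {T : X → X} (hT : Continuous T) {n : ℕ} (hn : 1 ≤ n) :
    Continuous fun x => empirical T x n := by
  refine continuous_iff_continuousAt.2 fun x => ?_
  refine ProbabilityMeasure.tendsto_iff_forall_integral_tendsto.2 fun f => ?_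
  simp only [integral_empirical T f.continuous.measurable _ hn]
  exact ((continuous_birkhoff hT f.continuous n).const_mul _).continuousAt

variable {S : Type*} {A : S → S → Prop} [TopologicalSpace S] [DiscreteTopology S]

lemma isOpen_setOf_lt_integral {ι : Type*} [Finite ι] {φs : ι → Space A → ℝ}
    (hφs : ∀ j, UnifCont A (φs j) ∧ Bdd A (φs j)) (α : ι → ℝ) :
    IsOpen {μ : ProbabilityMeasure (Space A) |
      ∀ j, α j < ∫ x, φs j x ∂(μ : Measure (Space A))} := by
  rw [Set.ofPred_forall]
  refine isOpen_iInter_of_finite fun j => ?_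
  obtain ⟨C, hC⟩ := (hφs j).2
  exact isOpen_lt continuous_const
    (ProbabilityMeasure.continuous_integral_boundedContinuousFunction
      (BoundedContinuousFunction.ofNormedAddCommGroup (φs j) (hφs j).1.continuous C hC))

lemma le_empDistr {ι : Type*} [Finite ι] {φs : ι → Space A → ℝ}
    (hφs : ∀ j, UnifCont A (φs j) ∧ Bdd A (φs j)) (α : ι → ℝ) {δ : ℝ} (hδ : 0 < δ)
    (ν : Measure (Space A)) [IsFiniteMeasure ν] {n : ℕ} (hn : 1 ≤ n) :
    ENNReal.ofReal (ν.real {x | ∀ j, n * (α j + δ) ≤ birkhoff (shift A) (φs j) n x}) ≤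
      empDistr (shift A) ν n {μ : ProbabilityMeasure (Space A) |
        ∀ j, α j < ∫ x, φs j x ∂(μ : Measure (Space A))} := by
  rw [empDistr, Measure.map_apply (continuous_empirical continuous_shift hn).measurable
    (isOpen_setOf_lt_integral hφs α).measurableSet, ofReal_measureReal]
  refine measure_mono fun x hx j => ?_
  have hn0 : (0 : ℝ) < n := by exact_mod_cast hn
  rw [integral_empirical _ (hφs j).1.continuous.measurable x hn, lt_inv_mul_iff₀ hn0]
  have := hx j
  nlinarith

end Empirical

end CMS

/-! ### Points with prescribed words in a finitely primitive shift -/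

namespace CMS

section Primitive

variable {S : Type*} {A : S → S → Prop}

lemma exists_point_of_isChain (y : Space A) : ∀ (l : List S) (s : S),
    List.IsChain A (s :: l ++ [y.1 0]) →
      ∃ x : Space A, x.1 0 = s ∧ (∀ i (h : i < l.length), x.1 (i + 1) = l[i]) ∧
        x.1 (l.length + 1) = y.1 0
  | [], s, h => by
    refine ⟨⟨fun i => Nat.casesOn i s y.1, fun i => ?_⟩, rfl, by simp, rfl⟩
    cases i with
    | zero => simpa using h
    | succ i => exact y.2 i
  | b :: l, s, h => by
    simp only [List.cons_append, List.isChain_cons_cons] at h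
    obtain ⟨x, h0, h1, h2⟩ := exists_point_of_isChain y l b (by simpa using h.2)
    refine ⟨⟨fun i => Nat.casesOn i s x.1, fun i => ?_⟩, rfl, fun i hi => ?_, h2⟩
    · cases i with
      | zero => simpa [h0] using h.1
      | succ i => exact x.2 i
    · cases i with
      | zero => simpa using h0
      | succ i => simpa using h1 i (by simpa using hi)

lemma exists_periodization (x : Space A) {n : ℕ} (hn : 1 ≤ n) (h : x.1 n = x.1 0) :
    ∃ z ∈ cyl x n, (shift A)^[n] z = z := by
  refine ⟨⟨fun i => x.1 (i % n), fun i => ?_⟩, fun i hi => ?_, Subtype.ext (funext fun i => ?_)⟩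
  · have h1 := x.2 (i % n)
    have h2 : i % n < n := Nat.mod_lt _ hn
    change A (x.1 (i % n)) (x.1 ((i + 1) % n))
    rw [← Nat.mod_add_mod]
    rcases (Nat.succ_le_of_lt h2).lt_or_eq with h3 | h3
    · rwa [Nat.mod_eq_of_lt h3]
    · rw [show i % n + 1 = n from h3] at h1 ⊢
      rwa [Nat.mod_self, ← h]
  · simp [Nat.mod_eq_of_lt hi]
  · refine (shift_iterate_apply _ n i).trans ?_
    change x.1 ((i + n) % n) = x.1 (i % n)
    rw [Nat.add_mod_right]

lemma eq_of_mem_cyl_of_preimSet {y x x' : Space A} {n : ℕ} (hx : x ∈ preimSet (shift A) n y)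
    (hx' : x' ∈ preimSet (shift A) n y) (h : x' ∈ cyl x n) : x' = x := by
  refine Subtype.ext (funext fun i => ?_)
  rcases lt_or_ge i n with hi | hi
  · exact h i hi
  · obtain ⟨j, rfl⟩ := Nat.exists_eq_add_of_le' hi
    rw [← shift_iterate_apply, ← shift_iterate_apply, show _ = y from hx', show _ = y from hx]

lemma eq_of_mem_cyl_of_perSet {x x' : Space A} {n : ℕ} (hn : 1 ≤ n)
    (hx : x ∈ perSet (shift A) n) (hx' : x' ∈ perSet (shift A) n) (h : x' ∈ cyl x n) :
    x' = x := by
  refine Subtype.ext (funext fun i => ?_)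
  induction i using Nat.strong_induction_on with
  | _ i ih =>
    rcases lt_or_ge i n with hi | hi
    · exact h i hi
    · obtain ⟨j, rfl⟩ := Nat.exists_eq_add_of_le' hi
      rw [← shift_iterate_apply, ← shift_iterate_apply, show _ = x' from hx', show _ = x from hx]
      exact ih j (by omega)

variable [TopologicalSpace S] {φ : Space A → ℝ} {ν : Measure (Space A)} {c₀ P : ℝ}

lemma FinitelyPrimitive.exists_links (hprim : FinitelyPrimitive A) (htrans : TopTransitive A)
    (hc : 1 ≤ c₀) (hG : IsGibbsWith A φ ν c₀ P) :
    ∃ (N : ℕ) (B : ℝ) (p : S → S → Space A), 0 ≤ B ∧ ∀ s s', (p s s').1 0 = s ∧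
      (p s s').1 (N + 1) = s' ∧ ∀ x : Space A, x ∈ cyl (shift A (p s s')) N →
        -B ≤ birkhoff (shift A) (fun x => φ x - P) N x := by
  obtain ⟨Λ, ⟨N, hN⟩, hΛ⟩ := hprim
  obtain ⟨β⟩ := htrans.nonempty_bridges
  set B : ℝ := Real.log c₀ + ∑ l ∈ Λ, |Real.log (ν.real (cylinder A l))| with hB
  have hc1 := Real.log_nonneg hc
  have hB0 : 0 ≤ B := add_nonneg hc1 (Finset.sum_nonneg fun _ _ => abs_nonneg _)
  have : ∀ s s', ∃ p : Space A, p.1 0 = s ∧ p.1 (N + 1) = s' ∧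
      ∀ x : Space A, x ∈ cyl (shift A p) N →
        -B ≤ birkhoff (shift A) (fun x => φ x - P) N x := fun s s' => by
    obtain ⟨l, hl, hadm⟩ := hΛ [s] [s'] ⟨by simp, List.isChain_singleton _⟩
      ⟨by simp, List.isChain_singleton _⟩
    obtain ⟨p, h0, h1, h2⟩ := exists_point_of_isChain (β.point s' s') l s
      (by rw [β.apply_zero]; exact hadm.2)
    rw [hN l hl, β.apply_zero] at h2
    refine ⟨p, h0, h2, fun x hx => ?_⟩
    rcases Nat.eq_zero_or_pos N with rfl | hpos
    · simpa [birkhoff] using hB0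
    · have hcyl : cyl x N = cylinder A l := by
        ext z
        have hxl : ∀ i (h : i < l.length), x.1 i = l[i] := fun i hi =>
          (hx i (hN l hl ▸ hi)).trans (h1 i hi)
        refine ⟨fun hz i => ?_, fun hz i hi => ?_⟩
        · exact (hz i (hN l hl ▸ i.2)).trans (hxl i i.2)
        · have hi' : i < l.length := by rwa [hN l hl]
          exact (hz ⟨i, hi'⟩).trans (hxl i hi').symm
      have h3 := hG.log_le hc hpos x
      have h4 := Finset.single_le_sum (f := fun l => |Real.log (ν.real (cylinder A l))|)
        (fun _ _ => abs_nonneg _) hl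
      have h5 := neg_abs_le (Real.log (ν.real (cylinder A l)))
      rw [hcyl] at h3
      rw [birkhoff_sub_const]
      simp only [hB] at *
      linarith
  choose p hp using this
  exact ⟨N, B, p, hB0, hp⟩

/-- The family `C` of sets of points contains, for each word, a point of `C (n + R)` that follows
the word `w` of length `n` from time `u` on, with almost the weight of the word. -/
def FollowsWords (φ : Space A → ℝ) (ν : Measure (Space A)) (P : ℝ) (C : ℕ → Set (Space A))
    (u R : ℕ) (B : ℝ) : Prop :=
  ∀ n, 1 ≤ n → ∀ w : Space A, ∃ z ∈ C (n + (u + R)), (shift A)^[u] z ∈ cyl w n ∧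
    Real.log (ν.real (cyl w n)) - B ≤ birkhoff (shift A) (fun x => φ x - P) (n + (u + R)) z

lemma FollowsWords.mono {C C' : ℕ → Set (Space A)} {u R : ℕ} {B : ℝ}
    (h : FollowsWords φ ν P C u R B) (hC : ∀ n, C n ⊆ C' n) : FollowsWords φ ν P C' u R B :=
  fun n hn w => (h n hn w).imp fun _ hz => ⟨hC _ hz.1, hz.2⟩

lemma exists_followsWords (hprim : FinitelyPrimitive A) (htrans : TopTransitive A)
    (hc : 1 ≤ c₀) (hG : IsGibbsWith A φ ν c₀ P) (a : S) (y : Space A) :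
    ∃ (u R : ℕ) (B : ℝ), FollowsWords φ ν P (fun n => cylinder A [a] ∩ perSet (shift A) n) u R B ∧
      FollowsWords φ ν P (fun n => cylinder A [a] ∩ preimSet (shift A) n y) u R B := by
  obtain ⟨N, B, p, hB0, hp⟩ := hprim.exists_links htrans hc hG
  obtain ⟨β⟩ := htrans.nonempty_bridges
  set a' := β.point a a with ha'
  have ha0 : a'.1 0 = a := β.apply_zero a a
  set B' : ℝ := 2 * B + 2 * Real.log c₀ + |Real.log (ν.real (cyl a' 1))| with hB'
  have key : ∀ n, 1 ≤ n → ∀ w y : Space A, ∃ x : Space A,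
      (shift A)^[n + (N + 1 + N)] x = y ∧ ∀ z ∈ cyl x (n + (N + 1 + N)),
      z ∈ cylinder A [a] ∧ (shift A)^[N + 1] z ∈ cyl w n ∧
        Real.log (ν.real (cyl w n)) - B' ≤
          birkhoff (shift A) (fun x => φ x - P) (n + (N + 1 + N)) z := fun n hn w y => by
    set v := glue (p (w.1 (n - 1)) (y.1 0)) (N + 1) y with hv
    set w' := glue w (n - 1) v with hw'
    have e1 : (p (w.1 (n - 1)) (y.1 0)).1 (N + 1) = y.1 0 := (hp _ _).2.1
    have hv1 : v ∈ cyl (p (w.1 (n - 1)) (y.1 0)) (N + 1) :=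
      cyl_anti _ (Nat.le_succ _) (glue_mem_cyl e1)
    have e2 : w.1 (n - 1) = v.1 0 := by rw [hv1 0 (by omega), (hp _ _).1]
    have hw1 : w' ∈ cyl w n := cyl_anti w (by omega) (glue_mem_cyl e2)
    have e3 : (p a (w.1 0)).1 (N + 1) = w'.1 0 := by rw [hw1 0 (by omega), (hp _ _).2.1]
    refine ⟨glue (p a (w.1 0)) (N + 1) w', ?_, fun z hz => ?_⟩
    · rw [show n + (N + 1 + N) = (N + 1) + (n - 1) + (N + 1) by omega, Function.iterate_add_apply,
        Function.iterate_add_apply, shift_iterate_glue e3, shift_iterate_glue e2,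
        shift_iterate_glue e1]
    have hz1 : z ∈ cyl (p a (w.1 0)) (N + 1) := fun i hi =>
      (hz i (by omega)).trans (glue_mem_cyl e3 i (by omega))
    have hz2 : (shift A)^[N + 1] z ∈ cyl w' (n + N) := by
      have := shift_iterate_mem_cyl hz (i := N + 1) (m := n + N) (by omega)
      rwa [shift_iterate_glue e3] at this
    have hz3 : (shift A)^[N + 1] z ∈ cyl w n := fun i hi =>
      (hz2 i (by omega)).trans (hw1 i hi)
    have hz4 : (shift A)^[n] ((shift A)^[N + 1] z) ∈ cyl (shift A (p (w.1 (n - 1)) (y.1 0))) N := by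
      have h1 := shift_iterate_mem_cyl hz2 (i := n - 1) (m := N + 1) (by omega)
      rw [shift_iterate_glue e2] at h1
      have h2 : (shift A)^[n - 1] ((shift A)^[N + 1] z) ∈ cyl (p (w.1 (n - 1)) (y.1 0)) (N + 1) :=
        fun i hi => (h1 i hi).trans (hv1 i hi)
      have h3 := shift_iterate_mem_cyl h2 (i := 1) (m := N) (by omega)
      rw [← Function.iterate_add_apply, show 1 + (n - 1) = n by omega] at h3
      exact h3
    have hz0 : z.1 0 = a := (hz1 0 (by omega)).trans (hp _ _).1
    refine ⟨fun i => ?_, hz3, ?_⟩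
    · have hi : (i : ℕ) = 0 := by
        have := i.2
        simp only [List.length_singleton] at this
        omega
      simpa [hi] using hz0
    · have hz5 : z ∈ cyl a' 1 := fun i hi => by
        rw [Nat.lt_one_iff.1 hi, hz0, ha0]
      have h1 := hG.log_le hc le_rfl z
      have h2 := (hp a (w.1 0)).2.2 (shift A z) (shift_iterate_mem_cyl hz1 (i := 1) (by omega))
      have h3 := hG.log_le hc hn ((shift A)^[N + 1] z)
      have h4 := (hp _ _).2.2 _ hz4
      rw [cyl_eq_of_mem hz5] at h1
      rw [cyl_eq_of_mem hz3] at h3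
      have h5 := neg_abs_le (Real.log (ν.real (cyl a' 1)))
      rw [show n + (N + 1 + N) = (1 + N) + (n + N) by omega, birkhoff_add, birkhoff_add,
        birkhoff_add, add_comm 1 N, birkhoff_sub_const _ _ _ 1, birkhoff_sub_const _ _ _ n]
      simp only [hB', Function.iterate_one] at *
      linarith
  refine ⟨N + 1, N, B', fun n hn w => ?_, fun n hn w => ?_⟩
  · obtain ⟨x, hx, hxz⟩ := key n hn w a'
    have hx0 : x.1 0 = a := (hxz x (mem_cyl_self _ _)).1 ⟨0, by simp⟩
    obtain ⟨z, hz, hper⟩ := exists_periodization x (n := n + (N + 1 + N)) (by omega) (by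
      have := shift_iterate_apply x (n + (N + 1 + N)) 0
      rw [hx, zero_add] at this
      rw [← this, ha0, hx0])
    exact ⟨z, ⟨(hxz z hz).1, hper⟩, (hxz z hz).2⟩
  · obtain ⟨x, hx, hxz⟩ := key n hn w y
    have h := hxz x (mem_cyl_self _ _)
    exact ⟨x, ⟨h.1, hx⟩, h.2⟩

end Primitive

end CMS

/-! ### The lower bound for weighted periodic points and preimages -/

namespace CMS

section Weighted

variable {S : Type*} {A : S → S → Prop} [TopologicalSpace S] [DiscreteTopology S]
  {φ : Space A → ℝ} {ν : Measure (Space A)} {c₀ P : ℝ}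

lemma Zfn_le [IsProbabilityMeasure ν] (hc : 1 ≤ c₀) (hG : IsGibbsWith A φ ν c₀ P) {n : ℕ}
    (hn : 1 ≤ n) {C : Set (Space A)} (hC : ∀ x ∈ C, ∀ x' ∈ C, x' ∈ cyl x n → x' = x) :
    Zfn (shift A) φ n C ≤ ENNReal.ofReal (c₀ * Real.exp (P * n)) := by
  have hterm : ∀ x : C, ENNReal.ofReal (Real.exp (birkhoff (shift A) φ n x)) ≤
      ENNReal.ofReal (c₀ * Real.exp (P * n)) * ν (cyl x.1 n) := fun x => by
    have h1 := hG.exp_le_real_cyl hn x.1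
    rw [← ofReal_measureReal, ← ENNReal.ofReal_mul (by positivity)]
    refine ENNReal.ofReal_le_ofReal ?_
    rw [birkhoff_sub_const, Real.exp_sub, inv_mul_le_iff₀ (by linarith),
      div_le_iff₀ (Real.exp_pos _)] at h1
    linarith
  refine (ENNReal.tsum_le_tsum hterm).trans ?_
  rw [ENNReal.tsum_mul_left]
  refine mul_le_of_le_one_right' ?_
  rw [← measure_univ (μ := ν)]
  refine tsum_measure_le_measure_univ (fun x => (measurableSet_cyl _ _).nullMeasurableSet) ?_
  intro x x' hne
  exact (cyl_disjoint fun h => hne (Subtype.ext (hC _ x.2 _ x'.2 h)).symm).aedisjoint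

variable [Countable S]

lemma FollowsWords.le_weightedDistr [IsProbabilityMeasure ν] (hc : 1 ≤ c₀)
    (hG : IsGibbsWith A φ ν c₀ P) {C : ℕ → Set (Space A)} {u R : ℕ} {B : ℝ}
    (h : FollowsWords φ ν P C u R B) {n : ℕ} (hn : 1 ≤ n)
    (hC : ∀ x ∈ C (n + (u + R)), ∀ x' ∈ C (n + (u + R)), x' ∈ cyl x (n + (u + R)) → x' = x)
    {V : Set (ProbabilityMeasure (Space A))} (hV : MeasurableSet V) {E : Set (Space A)}
    (hE : ∀ x ∈ E, ∀ z : Space A, (shift A)^[u] z ∈ cyl x n →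
      empirical (shift A) z (n + (u + R)) ∈ V) :
    ENNReal.ofReal (c₀⁻¹ * Real.exp (-B)) * ν E ≤
      weightedDistr (shift A) φ (n + (u + R)) (C (n + (u + R))) V := by
  set L := n + (u + R) with hL
  set W : Set (Fin n → S) := {w | ∃ x ∈ E, x ∈ wordFiber A w} with hW
  choose x hxE hxw using fun w : W => w.2
  choose z hzC hzx hz using fun w : W => h n hn (x w)
  have hzinj : Function.Injective fun w : W => (⟨z w, hzC w⟩ : C L) := fun w w' hww' => by
    have hzz : z w = z w' := congrArg Subtype.val hww'
    have h1 := hzx w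
    rw [hzz] at h1
    have h2 : x w' ∈ cyl (x w) n := by
      rw [← cyl_eq_of_mem h1, cyl_eq_of_mem (hzx w')]
      exact mem_cyl_self _ _
    refine Subtype.ext (funext fun i => ?_)
    have h3 : (x w).1 i = w.1 i := hxw w i
    have h4 : (x w').1 i = w'.1 i := hxw w' i
    rw [← h3, ← h4, h2 i i.2]
  have hcover : ν E ≤ ∑' w : W, ν (cyl (x w) n) := by
    refine (measure_mono fun y hy => ?_).trans (measure_iUnion_le _)
    have hyW : (fun i : Fin n => y.1 i) ∈ W := ⟨y, hy, fun _ => rfl⟩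
    refine Set.mem_iUnion.2 ⟨⟨_, hyW⟩, fun i hi => ?_⟩
    exact (hxw ⟨_, hyW⟩ ⟨i, hi⟩).symm
  have hterm : ∀ w : W, ENNReal.ofReal (Real.exp (P * L - B)) * ν (cyl (x w) n) ≤
      ENNReal.ofReal (Real.exp (birkhoff (shift A) φ L (z w))) := fun w => by
    rw [← ofReal_measureReal, ← ENNReal.ofReal_mul (Real.exp_pos _).le]
    refine ENNReal.ofReal_le_ofReal ?_
    rw [← Real.exp_log (hG.real_cyl_pos hc hn (x w)), ← Real.exp_add]
    have := hz w
    rw [birkhoff_sub_const] at this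
    exact Real.exp_le_exp.2 (by linarith)
  have hsum : ENNReal.ofReal (Real.exp (P * L - B)) * ν E ≤
      Measure.sum (fun y : C L => ENNReal.ofReal (Real.exp (birkhoff (shift A) φ L y)) •
        Measure.dirac (empirical (shift A) (y : Space A) L)) V := by
    rw [Measure.sum_apply _ hV]
    refine le_trans ?_ (ENNReal.tsum_comp_le_tsum_of_injective hzinj _)
    refine (mul_le_mul_right hcover _).trans ?_
    rw [← ENNReal.tsum_mul_left]
    refine ENNReal.tsum_le_tsum fun w => (hterm w).trans_eq ?_
    rw [Measure.smul_apply, Measure.dirac_apply' _ hV,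
      Set.indicator_of_mem (hE _ (hxE w) _ (hzx w))]
    simp
  rw [weightedDistr, Measure.smul_apply, smul_eq_mul]
  refine le_trans ?_ (mul_le_mul' (ENNReal.inv_le_inv.2 (Zfn_le hc hG (by omega) hC)) hsum)
  rw [← ENNReal.ofReal_inv_of_pos (by positivity), ← mul_assoc,
    ← ENNReal.ofReal_mul (by positivity), mul_inv, mul_assoc, ← Real.exp_neg, ← Real.exp_add]
  rw [show -(P * L) + (P * L - B) = -B by ring]

lemma FollowsWords.eventually_exp_le_weightedDistr [IsProbabilityMeasure ν] (hc : 1 ≤ c₀)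
    (hG : IsGibbsWith A φ ν c₀ P) (hφ : Measurable φ) (htrans : TopTransitive A)
    {ι : Type*} [Fintype ι] {φs : ι → Space A → ℝ} (hφs : ∀ j, UnifCont A (φs j) ∧ Bdd A (φs j))
    {α : ι → ℝ} {C : ℕ → Set (Space A)} {u R : ℕ} {B : ℝ} (h : FollowsWords φ ν P C u R B)
    (hC : ∀ n, 1 ≤ n → ∀ x ∈ C n, ∀ x' ∈ C n, x' ∈ cyl x n → x' = x)
    {μ : ProbabilityMeasure (Space A)}
    (hα : ∀ j, α j < ∫ x, φs j x ∂(μ : Measure (Space A))) {r : ℝ}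
    (hr : (r : EReal) < freeEnergy (shift A) φ P μ) :
    ∀ᶠ n : ℕ in atTop, ENNReal.ofReal (Real.exp (n * r)) ≤
      weightedDistr (shift A) φ n (C n) {μ : ProbabilityMeasure (Space A) |
        ∀ j, α j < ∫ x, φs j x ∂(μ : Measure (Space A))} := by
  obtain ⟨s, hrs, hs⟩ := EReal.lt_iff_exists_real_btwn.1 hr
  have hrs : r < s := EReal.coe_lt_coe_iff.1 hrs
  obtain ⟨δ, hδ, hev⟩ := exists_eventually_exp_le_real hc hG hφ htrans hφs hα hs
  obtain ⟨M, hM0, hM⟩ := exists_uniform_bound fun j => (hφs j).2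
  obtain ⟨D, hD0, hD⟩ := exists_uniform_variation hφs (half_pos hδ)
  have htend : ∀ ε : ℝ, 0 < ε → Tendsto (fun n : ℕ => (n : ℝ) * ε) atTop atTop := fun ε hε =>
    tendsto_natCast_atTop_atTop.atTop_mul_const hε
  have hall : ∀ᶠ n : ℕ in atTop, ENNReal.ofReal (Real.exp ((n + (u + R) : ℕ) * r)) ≤
      weightedDistr (shift A) φ (n + (u + R)) (C (n + (u + R)))
        {μ : ProbabilityMeasure (Space A) |
          ∀ j, α j < ∫ x, φs j x ∂(μ : Measure (Space A))} := by
    filter_upwards [hev, eventually_ge_atTop 1, (htend _ (sub_pos.2 hrs)).eventually_ge_atTop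
      ((u + R) * r + Real.log c₀ + B), Filter.eventually_all.2 fun j =>
      (htend _ (half_pos hδ)).eventually_gt_atTop ((u + R) * α j + D + M * (u + R))]
      with n hn hn1 hnr hnj
    refine le_trans ?_ (h.le_weightedDistr hc hG hn1 (hC _ (by omega))
      (isOpen_setOf_lt_integral hφs α).measurableSet
      (E := {x | ∀ j, n * (α j + δ) ≤ birkhoff (shift A) (φs j) n x}) ?_)
    · rw [← ofReal_measureReal, ← ENNReal.ofReal_mul (by positivity)]
      refine ENNReal.ofReal_le_ofReal (le_trans ?_ (mul_le_mul_of_nonneg_left hn (by positivity)))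
      rw [← Real.exp_log (show 0 < c₀ by linarith), ← Real.exp_neg, ← Real.exp_add,
        ← Real.exp_add]
      refine Real.exp_le_exp.2 ?_
      push_cast
      linarith
    · intro x hx z hz j
      have hL0 : (0 : ℝ) < (n + (u + R) : ℕ) := by exact_mod_cast (by omega : 0 < n + (u + R))
      rw [integral_empirical _ (hφs j).1.continuous.measurable z (by omega),
        lt_inv_mul_iff₀ hL0, show n + (u + R) = u + (n + R) by omega, birkhoff_add, birkhoff_add]
      have h1 := (abs_le.1 (abs_birkhoff_le (T := shift A) (hM j) u z)).1
      have h2 := (abs_le.1 (abs_birkhoff_le (T := shift A) (hM j) R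
        ((shift A)^[n] ((shift A)^[u] z)))).1
      have h3 := (abs_le.1 (hD j n x _ hz)).1
      have h4 := hx j
      have h5 := hnj j
      push_cast
      linarith
  filter_upwards [(tendsto_sub_atTop_nat (u + R)).eventually hall, eventually_ge_atTop (u + R)]
    with n hn hnR
  rwa [Nat.sub_add_cancel hnR] at hn

end Weighted

end CMS

open CMS in
/-- **Key large deviations lower bound.** For a transitive countable Markov shift with a Gibbs
state, bounded uniformly continuous `φ_1, …, φ_l` and reals `α_1, …, α_l`, with
`V = {μ : ∫φ_j dμ > α_j ∀j}`, we have `liminf (1/n) log ξ_n(V) ≥ sup_V F`; if the shift is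
finitely primitive the same holds for `η_n`, `η_{a,n}`, `ζ_{y,n}` and `ζ_{a,y,n}`. -/
theorem key_lower_bound {S : Type*} [Countable S] [TopologicalSpace S] [DiscreteTopology S]
    (A : S → S → Prop) (hA : NoZeroRowCol A) (htrans : TopTransitive A)
    (φ : Space A → ℝ) (hφ : Measurable φ)
    (μφ : ProbabilityMeasure (Space A)) (c₀ P : ℝ) (hc₀ : 1 ≤ c₀)
    (hGibbs : IsGibbsWith A φ (μφ : Measure (Space A)) c₀ P)
    (l : ℕ) (hl : 1 ≤ l) (φs : Fin l → Space A → ℝ)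
    (hφs : ∀ j, UnifCont A (φs j) ∧ Bdd A (φs j)) (αs : Fin l → ℝ) :
    (⨆ μ ∈ {μ : ProbabilityMeasure (Space A) |
        ∀ j, αs j < ∫ x, φs j x ∂(μ : Measure (Space A))},
      freeEnergy (shift A) φ P μ) ≤
      atTop.liminf (fun n : ℕ => (((n : ℝ)⁻¹ : ℝ) : EReal) *
        ENNReal.log (empDistr (shift A) (μφ : Measure (Space A)) n
          {μ : ProbabilityMeasure (Space A) |
            ∀ j, αs j < ∫ x, φs j x ∂(μ : Measure (Space A))})) ∧
    (FinitelyPrimitive A → ∀ a : S, ∀ y : Space A,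
      ∀ C ∈ ({perSet (shift A), fun n => cylinder A [a] ∩ perSet (shift A) n,
          fun n => preimSet (shift A) n y,
          fun n => cylinder A [a] ∩ preimSet (shift A) n y} :
            Set (ℕ → Set (Space A))),
        (⨆ μ ∈ {μ : ProbabilityMeasure (Space A) |
            ∀ j, αs j < ∫ x, φs j x ∂(μ : Measure (Space A))},
          freeEnergy (shift A) φ P μ) ≤
          atTop.liminf (fun n : ℕ => (((n : ℝ)⁻¹ : ℝ) : EReal) *
            ENNReal.log (weightedDistr (shift A) φ n (C n)
              {μ : ProbabilityMeasure (Space A) |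
                ∀ j, αs j < ∫ x, φs j x ∂(μ : Measure (Space A))}))) := by
  refine ⟨iSup_le_liminf_inv_mul_log fun μ hμ r hr => ?_,
    fun hprim a y C hC => iSup_le_liminf_inv_mul_log fun μ hμ r hr => ?_⟩
  · obtain ⟨δ, hδ, h⟩ := exists_eventually_exp_le_real hc₀ hGibbs hφ htrans hφs hμ hr
    filter_upwards [h, eventually_ge_atTop 1] with n hn hn1
    exact (ENNReal.ofReal_le_ofReal hn).trans (le_empDistr hφs αs hδ _ hn1)
  · obtain ⟨u, R, B, hper, hpre⟩ := exists_followsWords hprim htrans hc₀ hGibbs a y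
    have hper' : ∀ n, 1 ≤ n → ∀ x ∈ perSet (shift A) n, ∀ x' ∈ perSet (shift A) n,
        x' ∈ cyl x n → x' = x := fun n hn x hx x' hx' => eq_of_mem_cyl_of_perSet hn hx hx'
    have hpre' : ∀ n, 1 ≤ n → ∀ x ∈ preimSet (shift A) n y, ∀ x' ∈ preimSet (shift A) n y,
        x' ∈ cyl x n → x' = x := fun n _ x hx x' hx' => eq_of_mem_cyl_of_preimSet hx hx'
    rcases hC with rfl | rfl | rfl | rfl
    · exact (hper.mono fun _ => inter_subset_right).eventually_exp_le_weightedDistr hc₀ hGibbs hφ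
        htrans hφs hper' hμ hr
    · exact hper.eventually_exp_le_weightedDistr hc₀ hGibbs hφ htrans hφs
        (fun n hn x hx x' hx' => hper' n hn x hx.2 x' hx'.2) hμ hr
    · exact (hpre.mono fun _ => inter_subset_right).eventually_exp_le_weightedDistr hc₀ hGibbs hφ
        htrans hφs hpre' hμ hr
    · exact hpre.eventually_exp_le_weightedDistr hc₀ hGibbs hφ htrans hφs
        (fun n hn x hx x' hx' => hpre' n hn x hx.2 x' hx'.2) hμ hr
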